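/- arXiv:1710.05485 — 4 statements merged into one kernel-verified Lean document; each statement's English description precedes it below -/
import Mathlib

section
/- Fix constants d, r > 0, h, k ∈ (0,1) and c ≥ 0. If (φ, ψ) and (φ₁, ψ₁) are both semi-waves with speed c, then φ(s) = φ₁(s) and ψ(s) = ψ₁(s) for all s ∈ ℝ. -/
open Real Filter Set

noncomputable def uStar (h k : ℝ) : ℝ := (1 - k) / (1 - h * k)
noncomputable def vStar (h k : ℝ) : ℝ := (1 - h) / (1 - h * k)

/-- A semi-wave with speed `c` for the system
`φ'' - cφ' + φ(1 - φ - kψ) = 0` on `(0,∞)`,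
`dψ'' - cψ' + rψ(1 - ψ - hφ) = 0` on `ℝ`,
with `φ ≡ 0` on `(-∞,0]`, `ψ(-∞) = 1`, `(φ,ψ)(∞) = (u*, v*)`. -/
structure IsSemiWave (d r h k c : ℝ) (φ ψ : ℝ → ℝ) : Prop where
  cont_phi : Continuous φ
  smooth_phi : ContDiffOn ℝ 2 φ (Set.Ici 0)
  phi_zero : ∀ s ≤ (0:ℝ), φ s = 0
  smooth_psi : ContDiff ℝ 2 ψ
  ode_phi : ∀ s > (0:ℝ),
    deriv (deriv φ) s - c * deriv φ s + φ s * (1 - φ s - k * ψ s) = 0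
  phi_deriv_pos : ∀ s > (0:ℝ), 0 < deriv φ s
  ode_psi : ∀ s : ℝ,
    d * deriv (deriv ψ) s - c * deriv ψ s + r * ψ s * (1 - ψ s - h * φ s) = 0
  psi_deriv_neg : ∀ s : ℝ, deriv ψ s < 0
  psi_atBot : Filter.Tendsto ψ Filter.atBot (nhds 1)
  phi_atTop : Filter.Tendsto φ Filter.atTop (nhds (uStar h k))
  psi_atTop : Filter.Tendsto ψ Filter.atTop (nhds (vStar h k))

/-- second derivative test at a local maximum -/
theorem touch_max (z z1 : ℝ → ℝ) (z2 s : ℝ) (h1 : ∀ᶠ x in nhds s, HasDerivAt z (z1 x) x)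
    (h2 : HasDerivAt z1 z2 s) (hm : IsLocalMax z s) : z1 s = 0 ∧ z2 ≤ 0 := by
  have e : deriv z =ᶠ[nhds s] z1 := h1.mono fun x hx => hx.deriv
  have d1 : z1 s = 0 := hm.hasDerivAt_eq_zero h1.self_of_nhds
  refine ⟨d1, ?_⟩
  by_contra hpos
  push Not at hpos
  have e2 : deriv (deriv z) s = z2 := by rw [e.deriv_eq, h2.deriv]
  have hmin : IsLocalMin z s := isLocalMin_of_deriv_deriv_pos (by rw [e2]; exact hpos)
    (by rw [e.self_of_nhds, d1]) h1.self_of_nhds.continuousAt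
  have hc : z =ᶠ[nhds s] fun _ => z s := by
    filter_upwards [hm, hmin] with x a b
    exact le_antisymm a b
  have e3 : deriv (deriv z) s = 0 := by
    rw [hc.deriv.deriv_eq]; simp
  linarith

theorem smp (z z1 z2 : ℝ → ℝ) (C K a s₀ : ℝ) (hK : 0 < K) (ha : a < s₀)
    (h1 : ∀ s > a, HasDerivAt z (z1 s) s) (h2 : ∀ s > a, HasDerivAt z1 (z2 s) s)
    (hle : ∀ s > a, z2 s ≤ C * z1 s + K * z s) (hz : z s₀ = 0) (hz1 : z1 s₀ = 0) :
    ∀ s > a, z s ≤ 0 := by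
  obtain ⟨l, m, hlm, hlm2⟩ : ∃ l m : ℝ, l + m = C ∧ l * m = -K := by
    have := Real.sq_sqrt (show 0 ≤ C ^ 2 + 4 * K by positivity)
    refine ⟨(C + √(C ^ 2 + 4 * K)) / 2, (C - √(C ^ 2 + 4 * K)) / 2, by ring, by nlinarith⟩
  have hE : ∀ (b s : ℝ), HasDerivAt (fun s => Real.exp (-b * s)) (Real.exp (-b * s) * (-b)) s := by
    intro b s
    have := ((hasDerivAt_id s).const_mul (-b)).exp
    simpa using this
  have hv : ∀ s > a, HasDerivAt (fun s => Real.exp (-l * s) * (z1 s - m * z s))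
      (Real.exp (-l * s) * (z2 s - C * z1 s - K * z s)) s := by
    intro s hs
    have := (hE l s).mul ((h2 s hs).sub ((h1 s hs).const_mul m))
    refine this.congr_deriv ?_
    simp only [Pi.sub_apply]
    rw [← hlm]
    have : K = -(l * m) := by linarith
    rw [this]; ring
  have hanti : AntitoneOn (fun s => Real.exp (-l * s) * (z1 s - m * z s)) (Ioi a) := by
    refine antitoneOn_of_deriv_nonpos (convex_Ioi a)
      (fun s hs => (hv s hs).continuousAt.continuousWithinAt) ?_ ?_
    · rw [interior_Ioi]; exact fun s hs => (hv s hs).differentiableAt.differentiableWithinAt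
    · rw [interior_Ioi]; intro s hs
      rw [(hv s hs).deriv]
      exact mul_nonpos_of_nonneg_of_nonpos (Real.exp_pos _).le (by have := hle s hs; linarith)
  have hu : ∀ s > a, HasDerivAt (fun s => Real.exp (-m * s) * z s)
      (Real.exp (-m * s) * (z1 s - m * z s)) s := by
    intro s hs
    refine ((hE m s).mul (h1 s hs)).congr_deriv ?_
    ring
  intro s hs
  rcases le_total s s₀ with hss | hss
  · have hmono : MonotoneOn (fun s => Real.exp (-m * s) * z s) (Ioc a s₀) := by
      refine monotoneOn_of_deriv_nonneg (convex_Ioc a s₀)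
        (fun s hs => (hu s hs.1).continuousAt.continuousWithinAt) ?_ ?_
      · rw [interior_Ioc]; exact fun s hs => (hu s hs.1).differentiableAt.differentiableWithinAt
      · rw [interior_Ioc]; intro s hs
        rw [(hu s hs.1).deriv]
        have := hanti (show s ∈ Ioi a from hs.1) (show s₀ ∈ Ioi a from ha) hs.2.le
        simp only [hz, hz1] at this
        have h3 : 0 ≤ z1 s - m * z s := by
          by_contra hn
          push Not at hn
          have := mul_neg_of_pos_of_neg (Real.exp_pos (-l * s)) hn
          linarith
        exact mul_nonneg (Real.exp_pos _).le h3
    have := hmono (show s ∈ Ioc a s₀ from ⟨hs, hss⟩) ⟨ha, le_rfl⟩ hss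
    simp only [hz, mul_zero] at this
    by_contra hn
    push Not at hn
    have := mul_pos (Real.exp_pos (-m * s)) hn
    linarith
  · have hmono : AntitoneOn (fun s => Real.exp (-m * s) * z s) (Ici s₀) := by
      have hlt : ∀ s ∈ Ici s₀, a < s := fun s hs => ha.trans_le hs
      refine antitoneOn_of_deriv_nonpos (convex_Ici s₀)
        (fun s hs => (hu s (hlt s hs)).continuousAt.continuousWithinAt) ?_ ?_
      · rw [interior_Ici]
        exact fun s hs => (hu s (ha.trans hs)).differentiableAt.differentiableWithinAt
      · rw [interior_Ici]; intro s hs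
        rw [(hu s (ha.trans hs)).deriv]
        have := hanti (show s₀ ∈ Ioi a from ha) (show s ∈ Ioi a from ha.trans hs) (le_of_lt hs)
        simp only [hz, hz1] at this
        have h3 : z1 s - m * z s ≤ 0 := by
          by_contra hn
          push Not at hn
          have := mul_pos (Real.exp_pos (-l * s)) hn
          linarith
        exact mul_nonpos_of_nonneg_of_nonpos (Real.exp_pos _).le h3
    have := hmono (show s₀ ∈ Ici s₀ from self_mem_Ici) (show s ∈ Ici s₀ from hss) hss
    simp only [hz, mul_zero] at this
    by_contra hn
    push Not at hn
    have := mul_pos (Real.exp_pos (-m * s)) hn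
    linarith

theorem max_right (f : ℝ → ℝ) (hf : Continuous f) (M : ℝ) (hM : f M ≤ 0)
    (hlim : Tendsto f atTop (nhds 0)) (s₁ : ℝ) (hs₁ : M ≤ s₁) (hpos : 0 < f s₁) :
    ∃ s₀ > M, 0 < f s₀ ∧ ∀ s ≥ M, f s ≤ f s₀ := by
  obtain ⟨B, hB⟩ := eventually_atTop.1 (hlim.eventually (gt_mem_nhds hpos))
  obtain ⟨x, hx, hxm⟩ := (isCompact_Icc (a := M) (b := max B s₁)).exists_isMaxOn
    ⟨s₁, hs₁, le_max_right _ _⟩ hf.continuousOn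
  have h1 : f s₁ ≤ f x := hxm (show s₁ ∈ Icc _ _ from ⟨hs₁, le_max_right _ _⟩)
  refine ⟨x, ?_, by linarith, ?_⟩
  · refine lt_of_le_of_ne hx.1 ?_
    rintro rfl
    linarith
  · intro s hs
    rcases le_total s (max B s₁) with h | h
    · exact hxm (show s ∈ Icc _ _ from ⟨hs, h⟩)
    · exact (hB s ((le_max_left _ _).trans h)).le.trans h1

theorem max_left (f : ℝ → ℝ) (hf : Continuous f) (M : ℝ) (hM : f M ≤ 0)
    (hlim : Tendsto f atBot (nhds 0)) (s₁ : ℝ) (hs₁ : s₁ ≤ M) (hpos : 0 < f s₁) :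
    ∃ s₀ < M, 0 < f s₀ ∧ ∀ s ≤ M, f s ≤ f s₀ := by
  obtain ⟨x, hx, hx1, hx2⟩ := max_right (fun s => f (-s)) (by fun_prop) (-M) (by simpa using hM)
    (hlim.comp tendsto_neg_atTop_atBot) (-s₁) (by linarith) (by simpa using hpos)
  refine ⟨-x, by linarith, hx1, fun s hs => ?_⟩
  have := hx2 (-s) (by linarith)
  simpa using this

namespace IsSemiWave

variable {d r h k c : ℝ} {φ ψ : ℝ → ℝ}

theorem phi_d1 (w : IsSemiWave d r h k c φ ψ) {s : ℝ} (hs : 0 < s) :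
    HasDerivAt φ (deriv φ s) s := by
  have := w.smooth_phi.contDiffAt (Ici_mem_nhds hs)
  exact (this.differentiableAt (by norm_num)).hasDerivAt

theorem phi_d2 (w : IsSemiWave d r h k c φ ψ) {s : ℝ} (hs : 0 < s) :
    HasDerivAt (deriv φ) (deriv (deriv φ) s) s := by
  have h1 : ContDiffOn ℝ (1 + 1) φ (Ioi 0) := w.smooth_phi.mono Ioi_subset_Ici_self
  have h2 := ((contDiffOn_succ_iff_deriv_of_isOpen isOpen_Ioi).1 h1).2.2
  exact ((h2.contDiffAt (Ioi_mem_nhds hs)).differentiableAt (by norm_num)).hasDerivAt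

theorem psi_d1 (w : IsSemiWave d r h k c φ ψ) (s : ℝ) : HasDerivAt ψ (deriv ψ s) s :=
  (w.smooth_psi.differentiable (by norm_num) s).hasDerivAt

theorem psi_d2 (w : IsSemiWave d r h k c φ ψ) (s : ℝ) :
    HasDerivAt (deriv ψ) (deriv (deriv ψ) s) s :=
  (((contDiff_succ_iff_deriv (n := 1)).1 w.smooth_psi).2.2.differentiable (by norm_num) s).hasDerivAt

theorem phi_strict (w : IsSemiWave d r h k c φ ψ) : StrictMonoOn φ (Ici 0) := by
  refine strictMonoOn_of_deriv_pos (convex_Ici 0) w.cont_phi.continuousOn ?_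
  rw [interior_Ici]; exact fun s hs => w.phi_deriv_pos s hs

theorem phi_pos (w : IsSemiWave d r h k c φ ψ) {s : ℝ} (hs : 0 < s) : 0 < φ s := by
  have := w.phi_strict (show (0:ℝ) ∈ Ici 0 from self_mem_Ici) (show s ∈ Ici 0 from hs.le) hs
  rwa [w.phi_zero 0 le_rfl] at this

theorem phi_nonneg (w : IsSemiWave d r h k c φ ψ) (s : ℝ) : 0 ≤ φ s := by
  rcases le_or_gt s 0 with hs | hs
  · rw [w.phi_zero s hs]
  · exact (w.phi_pos hs).le

theorem phi_mono (w : IsSemiWave d r h k c φ ψ) : Monotone φ := by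
  intro s t hst
  rcases le_or_gt s 0 with hs | hs
  · rw [w.phi_zero s hs]; exact w.phi_nonneg t
  · exact w.phi_strict.monotoneOn (show s ∈ Ici 0 from hs.le) (show t ∈ Ici 0 from hs.le.trans hst) hst

theorem phi_lt (w : IsSemiWave d r h k c φ ψ) (s : ℝ) : φ s < uStar h k := by
  have h1 : φ (max s 0 + 1) ≤ uStar h k := w.phi_mono.ge_of_tendsto w.phi_atTop _
  have h2 : φ (max s 0) < φ (max s 0 + 1) := w.phi_strict (mem_Ici.2 (le_max_right _ _))
    (mem_Ici.2 ((le_max_right s 0).trans (by linarith))) (by linarith)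
  have h3 := w.phi_mono (le_max_left s 0)
  linarith

theorem psi_anti (w : IsSemiWave d r h k c φ ψ) : StrictAnti ψ :=
  strictAnti_of_deriv_neg w.psi_deriv_neg

theorem psi_gt (w : IsSemiWave d r h k c φ ψ) (s : ℝ) : vStar h k < ψ s := by
  have h1 : vStar h k ≤ ψ (s + 1) := w.psi_anti.antitone.le_of_tendsto w.psi_atTop _
  have h2 : ψ (s + 1) < ψ s := w.psi_anti (by linarith)
  linarith

theorem psi_le (w : IsSemiWave d r h k c φ ψ) (s : ℝ) : ψ s ≤ 1 :=
  w.psi_anti.antitone.ge_of_tendsto w.psi_atBot s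

end IsSemiWave

section Compare

variable {d r h k c : ℝ} {φ ψ φ₁ ψ₁ : ℝ → ℝ}

/-- the shifted functions are ordered -/
def ShiftOrd (φ ψ φ₁ ψ₁ : ℝ → ℝ) (τ : ℝ) : Prop :=
  ∀ s, φ₁ s ≤ φ (s + τ) ∧ ψ (s + τ) ≤ ψ₁ s

theorem hasDerivAt_shift {f f' : ℝ → ℝ} {s τ : ℝ} (hf : HasDerivAt f (f' (s + τ)) (s + τ)) :
    HasDerivAt (fun s => f (s + τ)) (f' (s + τ)) s := hf.comp_add_const s τ

theorem star_facts (hh : h ∈ Set.Ioo (0:ℝ) 1) (hk : k ∈ Set.Ioo (0:ℝ) 1) :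
    0 < uStar h k ∧ 0 < vStar h k ∧ uStar h k ≤ 1 ∧ 1 - uStar h k - k * vStar h k = 0 ∧
      1 - vStar h k - h * uStar h k = 0 := by
  obtain ⟨h0, h1⟩ := hh
  obtain ⟨k0, k1⟩ := hk
  have hD : 0 < 1 - h * k := by nlinarith
  have hD' : 1 - h * k ≠ 0 := hD.ne'
  unfold uStar vStar
  refine ⟨div_pos (by linarith) hD, div_pos (by linarith) hD, ?_, ?_, ?_⟩
  · rw [div_le_one hD]; nlinarith
  · have : 1 - (1 - k) / (1 - h * k) - k * ((1 - h) / (1 - h * k))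
        = ((1 - h * k) - (1 - k) - k * (1 - h)) / (1 - h * k) := by
      rw [sub_div (_ - _), sub_div (1 - h * k), div_self hD', mul_div_assoc]
    rw [this]; ring_nf
  · have : 1 - (1 - h) / (1 - h * k) - h * ((1 - k) / (1 - h * k))
        = ((1 - h * k) - (1 - h) - h * (1 - k)) / (1 - h * k) := by
      rw [sub_div (_ - _), sub_div (1 - h * k), div_self hD', mul_div_assoc]
    rw [this]; ring_nf

theorem extend_right (hd : 0 < d) (hr : 0 < r)
    (hh : h ∈ Set.Ioo (0:ℝ) 1) (hk : k ∈ Set.Ioo (0:ℝ) 1)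
    (w : IsSemiWave d r h k c φ ψ) (w₁ : IsSemiWave d r h k c φ₁ ψ₁) :
    ∃ M > 0, ∀ τ ≥ 0, φ₁ M ≤ φ (M + τ) → ψ (M + τ) ≤ ψ₁ M →
      ∀ s ≥ M, φ₁ s ≤ φ (s + τ) ∧ ψ (s + τ) ≤ ψ₁ s := by
  obtain ⟨hu, hv, -, e1, e2⟩ := star_facts hh hk
  obtain ⟨h0, h1⟩ := hh
  obtain ⟨k0, k1⟩ := hk
  have hA : ∀ᶠ s in atTop, uStar h k / 2 < φ s :=
    w.phi_atTop.eventually (lt_mem_nhds (by linarith))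
  have t1 : Tendsto (fun s => 1 - φ₁ s - k * ψ₁ s) atTop (nhds 0) := by
    rw [← e1]
    exact (tendsto_const_nhds.sub w₁.phi_atTop).sub (w₁.psi_atTop.const_mul k)
  have t2 : Tendsto (fun s => 1 - ψ₁ s - h * φ₁ s) atTop (nhds 0) := by
    rw [← e2]
    exact (tendsto_const_nhds.sub w₁.psi_atTop).sub (w₁.phi_atTop.const_mul h)
  have hB := t1.eventually (gt_mem_nhds (show 0 < (1 - k) * (uStar h k / 2) from
    mul_pos (by linarith) (by linarith)))
  have hC := t2.eventually (gt_mem_nhds (show 0 < (1 - h) * vStar h k from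
    mul_pos (by linarith) (by linarith)))
  obtain ⟨M₀, hM₀⟩ := eventually_atTop.1 (hA.and (hB.and hC))
  refine ⟨max M₀ 1, lt_of_lt_of_le one_pos (le_max_right _ _), ?_⟩
  set M := max M₀ 1 with hMdef
  have hM1 : 1 ≤ M := le_max_right _ _
  intro τ hτ hφM hψM
  by_contra hcon
  push Not at hcon
  obtain ⟨s₁, hs₁, hbad⟩ := hcon
  have hτs : Tendsto (fun s : ℝ => s + τ) atTop atTop := tendsto_atTop_add_const_right _ _ tendsto_id
  have l1 : Tendsto (fun s => φ₁ s - φ (s + τ)) atTop (nhds 0) := by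
    have := w₁.phi_atTop.sub (w.phi_atTop.comp hτs)
    simpa using this
  have l2 : Tendsto (fun s => ψ (s + τ) - ψ₁ s) atTop (nhds 0) := by
    have := (w.psi_atTop.comp hτs).sub w₁.psi_atTop
    simpa using this
  have cφ := w.cont_phi
  have cφ₁ := w₁.cont_phi
  have cψ := w.smooth_psi.continuous
  have cψ₁ := w₁.smooth_psi.continuous
  have hl : Tendsto (fun s => max (φ₁ s - φ (s + τ)) (ψ (s + τ) - ψ₁ s)) atTop (nhds 0) := by
    simpa using l1.max l2
  obtain ⟨s, hsM, hpos, hmax⟩ := max_right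
    (fun s => max (φ₁ s - φ (s + τ)) (ψ (s + τ) - ψ₁ s)) (by fun_prop) M
    (max_le (by linarith) (by linarith)) hl s₁ hs₁ (by
      rcases le_or_gt (φ₁ s₁) (φ (s₁ + τ)) with h' | h'
      · exact lt_max_of_lt_right (by linarith [hbad h'])
      · exact lt_max_of_lt_left (by linarith))
  try simp only at hpos hmax
  have hs0 : 0 < s := by linarith
  have hsτ : 0 < s + τ := by linarith
  obtain ⟨b1, b2, b3⟩ := hM₀ s ((le_max_left _ _).trans hsM.le)
  have hmon := w.phi_mono (show s ≤ s + τ by linarith)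
  have hq := w.psi_gt (s + τ)
  have hnhds : ∀ᶠ x in nhds s, M ≤ x := Ici_mem_nhds hsM
  have hnhds0 : ∀ᶠ x in nhds s, 0 < x := Ioi_mem_nhds hs0
  have o1 := w₁.ode_phi s hs0
  have o2 := w.ode_phi _ hsτ
  have o3 := w₁.ode_psi s
  have o4 := w.ode_psi (s + τ)
  rcases le_total (ψ (s + τ) - ψ₁ s) (φ₁ s - φ (s + τ)) with hc1 | hc1
  · rw [max_eq_left hc1] at hpos hmax
    have hlm : IsLocalMax (fun s => φ₁ s - φ (s + τ)) s := by
      filter_upwards [hnhds] with x hx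
      exact (le_max_left _ _).trans (hmax x hx)
    obtain ⟨z1, z2⟩ := touch_max _ (fun s => deriv φ₁ s - deriv φ (s + τ)) _ s
      (by
        filter_upwards [hnhds0] with x hx
        exact (w₁.phi_d1 hx).sub (hasDerivAt_shift (w.phi_d1 (by linarith))))
      ((w₁.phi_d2 hs0).sub (hasDerivAt_shift (f' := deriv (deriv φ)) (w.phi_d2 hsτ))) hlm
    try simp only at z1
    set a := φ₁ s
    set b := φ (s + τ)
    set p := ψ₁ s
    set q := ψ (s + τ)
    have key : b * (1 - b - k * q) ≤ a * (1 - a - k * p) := by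
      have : deriv φ₁ s = deriv φ (s + τ) := by linarith
      rw [this] at o1
      linarith
    have hb : 0 < b := w.phi_pos hsτ
    have k2 : b * (k * q) ≤ b * (k * (p + (a - b))) := by
      gcongr
      linarith
    have k3 : (a - b) * (1 - a - k * p) < (a - b) * ((1 - k) * b) := by
      apply mul_lt_mul_of_pos_left _ hpos
      have : (1 - k) * (uStar h k / 2) ≤ (1 - k) * b := by
        apply mul_le_mul_of_nonneg_left _ (by linarith)
        linarith
      linarith
    linarith
  · rw [max_eq_right hc1] at hpos hmax
    have hlm : IsLocalMax (fun s => ψ (s + τ) - ψ₁ s) s := by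
      filter_upwards [hnhds] with x hx
      exact (le_max_right _ _).trans (hmax x hx)
    obtain ⟨z1, z2⟩ := touch_max _ (fun s => deriv ψ (s + τ) - deriv ψ₁ s) _ s
      (Eventually.of_forall fun x => (hasDerivAt_shift (w.psi_d1 _)).sub (w₁.psi_d1 x))
      ((hasDerivAt_shift (f' := deriv (deriv ψ)) (w.psi_d2 (s + τ))).sub (w₁.psi_d2 s)) hlm
    try simp only at z1
    set a := φ₁ s
    set b := φ (s + τ)
    set p := ψ₁ s
    set q := ψ (s + τ)
    have key : p * (1 - p - h * a) ≤ q * (1 - q - h * b) := by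
      have e : deriv ψ₁ s = deriv ψ (s + τ) := by linarith
      rw [e] at o3
      have := mul_nonpos_of_nonneg_of_nonpos hd.le z2
      refine le_of_mul_le_mul_left ?_ hr
      linarith
    have hq0 : 0 < q := by linarith
    have k2 : q * (h * (a - b)) ≤ q * (h * (q - p)) := by
      gcongr
    have k3 : (q - p) * (1 - p - h * a) < (q - p) * ((1 - h) * q) := by
      apply mul_lt_mul_of_pos_left _ hpos
      have : (1 - h) * vStar h k ≤ (1 - h) * q :=
        mul_le_mul_of_nonneg_left hq.le (by linarith)
      linarith
    linarith

theorem extend_left (hd : 0 < d) (hr : 0 < r) (hh : h ∈ Set.Ioo (0:ℝ) 1)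
    (w : IsSemiWave d r h k c φ ψ) (w₁ : IsSemiWave d r h k c φ₁ ψ₁)
    (hv : 0 < vStar h k) :
    ∃ N > 0, ∀ τ ≥ 0, ψ (-N + τ) ≤ ψ₁ (-N) → ∀ s ≤ -N, ψ (s + τ) ≤ ψ₁ s := by
  obtain ⟨B, hB⟩ := eventually_atBot.1
    (w₁.psi_atBot.eventually (lt_mem_nhds (show (1 / 2 : ℝ) < 1 by norm_num)))
  refine ⟨max (-B) 1, lt_of_lt_of_le one_pos (le_max_right _ _), ?_⟩
  set N := max (-B) 1 with hN
  have hN1 : 1 ≤ N := le_max_right _ _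
  have hNB : -B ≤ N := le_max_left _ _
  intro τ hτ hψN
  by_contra hcon
  push Not at hcon
  obtain ⟨s₁, hs₁, hbad⟩ := hcon
  have hτs : Tendsto (fun s : ℝ => s + τ) atBot atBot := tendsto_atBot_add_const_right _ _ tendsto_id
  have l2 : Tendsto (fun s => ψ (s + τ) - ψ₁ s) atBot (nhds 0) := by
    have := (w.psi_atBot.comp hτs).sub w₁.psi_atBot
    simpa using this
  have cψ := w.smooth_psi.continuous
  have cψ₁ := w₁.smooth_psi.continuous
  obtain ⟨s, hsM, hpos, hmax⟩ := max_left (fun s => ψ (s + τ) - ψ₁ s) (by fun_prop) (-N)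
    (by linarith) l2 s₁ hs₁ (by linarith)
  try simp only at hpos hmax
  have hlm : IsLocalMax (fun s => ψ (s + τ) - ψ₁ s) s := by
    filter_upwards [Iic_mem_nhds hsM] with x hx
    exact hmax x hx
  obtain ⟨z1, z2⟩ := touch_max _ (fun s => deriv ψ (s + τ) - deriv ψ₁ s) _ s
    (Eventually.of_forall fun x => (hasDerivAt_shift (w.psi_d1 _)).sub (w₁.psi_d1 x))
    ((hasDerivAt_shift (f' := deriv (deriv ψ)) (w.psi_d2 (s + τ))).sub (w₁.psi_d2 s)) hlm
  try simp only at z1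
  have o3 := w₁.ode_psi s
  have o4 := w.ode_psi (s + τ)
  have hp := hB s (by linarith)
  have hb := w.phi_nonneg (s + τ)
  rw [w₁.phi_zero s (by linarith)] at o3
  set b := φ (s + τ)
  set p := ψ₁ s
  set q := ψ (s + τ)
  have key : p * (1 - p - h * 0) ≤ q * (1 - q - h * b) := by
    have e : deriv ψ₁ s = deriv ψ (s + τ) := by linarith
    rw [e] at o3
    have := mul_nonpos_of_nonneg_of_nonpos hd.le z2
    refine le_of_mul_le_mul_left ?_ hr
    linarith
  have h1 : 0 ≤ q * (h * b) := mul_nonneg (by linarith) (mul_nonneg hh.1.le hb)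
  nlinarith

theorem strict_of_ord (hd : 0 < d) (hr : 0 < r)
    (hh : h ∈ Set.Ioo (0:ℝ) 1) (hk : k ∈ Set.Ioo (0:ℝ) 1)
    (w : IsSemiWave d r h k c φ ψ) (w₁ : IsSemiWave d r h k c φ₁ ψ₁)
    (τ : ℝ) (hτ : 0 < τ) (ho : ShiftOrd φ ψ φ₁ ψ₁ τ) :
    (∀ s ≥ 0, φ₁ s < φ (s + τ)) ∧ ∀ s, ψ (s + τ) < ψ₁ s := by
  obtain ⟨hu, hv, hu1, e1, e2⟩ := star_facts hh hk
  have cφ := w.cont_phi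
  have cφ₁ := w₁.cont_phi
  have hφ : ∀ s ≥ 0, φ₁ s < φ (s + τ) := by
    intro s hs
    have hz0 : 0 < φ (0 + τ) - φ₁ 0 := by
      rw [w₁.phi_zero 0 le_rfl]
      linarith [w.phi_pos (show 0 < 0 + τ by linarith)]
    refine lt_of_le_of_ne (ho s).1 ?_
    intro heq
    have hs0 : 0 < s := by
      refine lt_of_le_of_ne hs ?_
      rintro rfl
      linarith
    have D1 : ∀ x > 0, HasDerivAt (fun x => φ (x + τ) - φ₁ x) (deriv φ (x + τ) - deriv φ₁ x) x :=
      fun x hx => (hasDerivAt_shift (w.phi_d1 (by linarith))).sub (w₁.phi_d1 hx)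
    have D2 : ∀ x > 0, HasDerivAt (fun x => deriv φ (x + τ) - deriv φ₁ x)
        (deriv (deriv φ) (x + τ) - deriv (deriv φ₁) x) x :=
      fun x hx => (hasDerivAt_shift (f' := deriv (deriv φ)) (w.phi_d2 (by linarith))).sub
        (w₁.phi_d2 hx)
    have hmin : IsLocalMin (fun x => φ (x + τ) - φ₁ x) s := by
      refine Eventually.of_forall fun x => ?_
      have := (ho x).1
      try simp only
      linarith
    have hz1 := hmin.hasDerivAt_eq_zero (D1 s hs0)
    have hle := smp (fun x => φ (x + τ) - φ₁ x) (fun x => deriv φ (x + τ) - deriv φ₁ x)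
      (fun x => deriv (deriv φ) (x + τ) - deriv (deriv φ₁) x) c 2 0 s two_pos hs0 D1 D2
      (by
        intro x hx
        have o1 := w₁.ode_phi x hx
        have o2 := w.ode_phi (x + τ) (by linarith)
        obtain ⟨i1, i2⟩ := ho x
        have j1 := w.phi_nonneg (x + τ)
        have j2 := w.phi_lt (x + τ)
        have j3 := w₁.phi_lt x
        have j4 := w₁.psi_gt x
        have j5 := w₁.psi_le x
        try simp only
        set a := φ₁ x
        set b := φ (x + τ)
        set p := ψ₁ x
        set q := ψ (x + τ)
        have k1 : b * (k * q) ≤ b * (k * p) :=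
          mul_le_mul_of_nonneg_left (mul_le_mul_of_nonneg_left i2 hk.1.le) j1
        have k2 : 0 ≤ (b - a) * (2 + (1 - k * p - a - b)) := by
          refine mul_nonneg (by linarith) ?_
          have : k * p ≤ 1 := by nlinarith [hk.1, hk.2]
          linarith
        linarith)
      (by linarith) hz1
    have hcl : (fun x => φ (x + τ) - φ₁ x) 0 ≤ 0 := by
      have hct : Tendsto (fun x => φ (x + τ) - φ₁ x) (nhdsWithin 0 (Ioi 0))
          (nhds ((fun x => φ (x + τ) - φ₁ x) 0)) :=
        (show Continuous (fun x => φ (x + τ) - φ₁ x) by fun_prop).continuousAt.mono_left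
          nhdsWithin_le_nhds
      exact le_of_tendsto hct (eventually_mem_nhdsWithin.mono fun x hx => hle x hx)
    try simp only at hcl
    linarith
  refine ⟨hφ, fun s => ?_⟩
  refine lt_of_le_of_ne (ho s).2 ?_
  intro heq
  have D1 : ∀ x, HasDerivAt (fun x => ψ₁ x - ψ (x + τ)) (deriv ψ₁ x - deriv ψ (x + τ)) x :=
    fun x => (w₁.psi_d1 x).sub (hasDerivAt_shift (w.psi_d1 _))
  have D2 : ∀ x, HasDerivAt (fun x => deriv ψ₁ x - deriv ψ (x + τ))
      (deriv (deriv ψ₁) x - deriv (deriv ψ) (x + τ)) x :=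
    fun x => (w₁.psi_d2 x).sub (hasDerivAt_shift (f' := deriv (deriv ψ)) (w.psi_d2 _))
  have hmin : ∀ t, ψ (t + τ) = ψ₁ t → IsLocalMin (fun x => ψ₁ x - ψ (x + τ)) t := by
    intro t ht
    refine Eventually.of_forall fun x => ?_
    have := (ho x).2
    try simp only
    linarith
  have hz1 := (hmin s heq).hasDerivAt_eq_zero (D1 s)
  have hle := smp (fun x => ψ₁ x - ψ (x + τ)) (fun x => deriv ψ₁ x - deriv ψ (x + τ))
    (fun x => deriv (deriv ψ₁) x - deriv (deriv ψ) (x + τ)) (c / d) (2 * r / d) (s - 1) s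
    (by positivity) (by linarith) (fun x _ => D1 x) (fun x _ => D2 x)
    (by
      intro x _
      have o3 := w₁.ode_psi x
      have o4 := w.ode_psi (x + τ)
      obtain ⟨i1, i2⟩ := ho x
      have j1 := w₁.phi_nonneg x
      have j2 := w.phi_lt (x + τ)
      have j3 := w₁.phi_lt x
      have j4 := w₁.psi_gt x
      have j5 := w₁.psi_le x
      have j6 := w.psi_gt (x + τ)
      have j7 := w.psi_le (x + τ)
      try simp only
      set a := φ₁ x
      set b := φ (x + τ)
      set p := ψ₁ x
      set q := ψ (x + τ)
      have k1 : q * (h * a) ≤ q * (h * b) :=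
        mul_le_mul_of_nonneg_left (mul_le_mul_of_nonneg_left i1 hh.1.le) (by linarith)
      have k2 : 0 ≤ (p - q) * (2 + (1 - p - q - h * a)) := by
        refine mul_nonneg (by linarith) ?_
        have : h * a ≤ 1 := by nlinarith [hh.1, hh.2]
        linarith
      have k3 : r * (q * (1 - q - h * b) - p * (1 - p - h * a)) ≤ r * (2 * (p - q)) :=
        mul_le_mul_of_nonneg_left (by linarith) hr.le
      have : c / d * (deriv ψ₁ x - deriv ψ (x + τ)) + 2 * r / d * (p - q)
        = (c * (deriv ψ₁ x - deriv ψ (x + τ)) + 2 * r * (p - q)) / d := by ring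
      rw [this, le_div_iff₀ hd]
      linarith)
    (by linarith) hz1
  set t := max s 0 with ht
  have ht0 : 0 ≤ t := le_max_right _ _
  have hts : s ≤ t := le_max_left _ _
  have hteq : ψ (t + τ) = ψ₁ t := by
    have h1 := hle t (by linarith)
    try simp only at h1
    exact le_antisymm (ho t).2 (by linarith)
  have hlt := hφ t ht0
  have hmx : IsLocalMax (fun x => -(ψ₁ x - ψ (x + τ))) t := (hmin t hteq).neg
  obtain ⟨z1, z2⟩ := touch_max _ (fun x => -(deriv ψ₁ x - deriv ψ (x + τ))) _ t
    (Eventually.of_forall fun x => (D1 x).neg) (D2 t).neg hmx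
  try simp only at z1
  have o3 := w₁.ode_psi t
  have o4 := w.ode_psi (t + τ)
  have e : deriv ψ₁ t = deriv ψ (t + τ) := by linarith
  have hp := w₁.psi_gt t
  rw [hteq, ← e] at o4
  have k1 : 0 < r * ψ₁ t * (h * (φ (t + τ) - φ₁ t)) :=
    mul_pos (mul_pos hr (by linarith)) (mul_pos hh.1 (by linarith))
  have k2 := mul_nonpos_of_nonneg_of_nonpos hd.le z2
  linarith

theorem half (hd : 0 < d) (hr : 0 < r)
    (hh : h ∈ Set.Ioo (0:ℝ) 1) (hk : k ∈ Set.Ioo (0:ℝ) 1)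
    (w : IsSemiWave d r h k c φ ψ) (w₁ : IsSemiWave d r h k c φ₁ ψ₁) :
    ShiftOrd φ ψ φ₁ ψ₁ 0 := by
  obtain ⟨hu, hv, hu1, e1, e2⟩ := star_facts hh hk
  obtain ⟨M, hM, hright⟩ := extend_right hd hr hh hk w w₁
  obtain ⟨N, hN, hleft⟩ := extend_left hd hr hh w w₁ hv
  have cφ := w.cont_phi
  have cψ := w.smooth_psi.continuous
  have cφ₁ := w₁.cont_phi
  have cψ₁ := w₁.smooth_psi.continuous
  have ext : ∀ τ ≥ 0, (∀ s ∈ Icc 0 M, φ₁ s ≤ φ (s + τ)) →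
      (∀ s ∈ Icc (-N) M, ψ (s + τ) ≤ ψ₁ s) → ShiftOrd φ ψ φ₁ ψ₁ τ := by
    intro τ hτ h1 h2 s
    have hR := hright τ hτ (h1 M ⟨hM.le, le_rfl⟩) (h2 M ⟨by linarith, le_rfl⟩)
    have hL := hleft τ hτ (h2 (-N) ⟨le_rfl, by linarith⟩)
    rcases le_total M s with hs | hs
    · exact hR s hs
    · constructor
      · rcases le_total s 0 with h0 | h0
        · rw [w₁.phi_zero s h0]; exact w.phi_nonneg _
        · exact h1 s ⟨h0, hs⟩
      · rcases le_total s (-N) with h0 | h0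
        · exact hL s h0
        · exact h2 s ⟨h0, hs⟩
  set S : Set ℝ := {τ | 0 ≤ τ ∧ ShiftOrd φ ψ φ₁ ψ₁ τ} with hS
  have hclosed : IsClosed S := by
    have : S = Ici 0 ∩ ⋂ s, ({τ | φ₁ s ≤ φ (s + τ)} ∩ {τ | ψ (s + τ) ≤ ψ₁ s}) := by
      ext τ
      simp [hS, ShiftOrd]
    rw [this]
    refine isClosed_Ici.inter (isClosed_iInter fun s => ?_)
    exact (isClosed_le (by fun_prop) (by fun_prop)).inter (isClosed_le (by fun_prop) (by fun_prop))
  have hne : S.Nonempty := by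
    have a1 := w.phi_atTop.eventually (lt_mem_nhds (w₁.phi_lt M))
    have a2 := w.psi_atTop.eventually (gt_mem_nhds (w₁.psi_gt M))
    obtain ⟨T, hT⟩ := eventually_atTop.1 (a1.and a2)
    have hT0 : 0 ≤ max T 0 + N := by linarith [le_max_right T 0]
    refine ⟨max T 0 + N, hT0, ext _ hT0 ?_ ?_⟩
    · intro s hs
      have := (hT (s + (max T 0 + N)) (by linarith [le_max_left T 0, hs.1])).1
      exact (w₁.phi_mono hs.2).trans this.le
    · intro s hs
      have := (hT (s + (max T 0 + N)) (by linarith [le_max_left T 0, hs.1])).2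
      exact this.le.trans (w₁.psi_anti.antitone hs.2)
  have hbdd : BddBelow S := ⟨0, fun τ hτ => hτ.1⟩
  obtain ⟨hT0, hTo⟩ := hclosed.csInf_mem hne hbdd
  set T := sInf S with hTdef
  rcases hT0.eq_or_lt with h0 | h0
  · rw [h0]; exact hTo
  exfalso
  obtain ⟨s1, s2⟩ := strict_of_ord hd hr hh hk w w₁ T h0 hTo
  have E1 : ∀ᶠ τ in nhds T, ∀ s ∈ Icc 0 M, φ₁ s < φ (s + τ) := by
    refine isCompact_Icc.eventually_forall_of_forall_eventually fun s hs => ?_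
    exact (isOpen_lt (f := fun q : ℝ × ℝ => φ₁ q.2) (g := fun q : ℝ × ℝ => φ (q.2 + q.1))
      (by fun_prop) (by fun_prop)).mem_nhds (s1 s hs.1)
  have E2 : ∀ᶠ τ in nhds T, ∀ s ∈ Icc (-N) M, ψ (s + τ) < ψ₁ s := by
    refine isCompact_Icc.eventually_forall_of_forall_eventually fun s hs => ?_
    exact (isOpen_lt (f := fun q : ℝ × ℝ => ψ (q.2 + q.1)) (g := fun q : ℝ × ℝ => ψ₁ q.2)
      (by fun_prop) (by fun_prop)).mem_nhds (s2 s)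
  have E3 : ∀ᶠ τ in nhds T, 0 < τ := Ioi_mem_nhds h0
  have E := ((E1.and (E2.and E3)).filter_mono (nhdsWithin_le_nhds (s := Iio T))).and
    eventually_mem_nhdsWithin
  obtain ⟨τ, ⟨f1, f2, f3⟩, f4⟩ := E.exists
  have hmem : τ ∈ S := ⟨f3.le, ext τ f3.le (fun s hs => (f1 s hs).le) fun s hs => (f2 s hs).le⟩
  have := csInf_le hbdd hmem
  exact absurd f4 (not_lt.2 this)

end Compare

theorem stmt6 (d r h k c : ℝ) (hd : 0 < d) (hr : 0 < r)
    (hh : h ∈ Set.Ioo (0:ℝ) 1) (hk : k ∈ Set.Ioo (0:ℝ) 1) (hc : 0 ≤ c)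
    (φ ψ φ₁ ψ₁ : ℝ → ℝ)
    (hsw : IsSemiWave d r h k c φ ψ) (hsw₁ : IsSemiWave d r h k c φ₁ ψ₁) :
    ∀ s : ℝ, φ s = φ₁ s ∧ ψ s = ψ₁ s := by
  intro s
  have h1 := half hd hr hh hk hsw hsw₁ s
  have h2 := half hd hr hh hk hsw₁ hsw s
  rw [add_zero] at h1 h2
  exact ⟨le_antisymm h2.1 h1.1, le_antisymm h1.2 h2.2⟩
end

section
/- Fix constants d, r > 0, h, k ∈ (0,1) and c ≥ 0. If there exists an entire wave with speed c, then there is no semi-wave with speed c. -/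
open Real Filter Set

/-- An entire (traveling) wave with speed `c` for the system
`Φ'' - cΦ' + Φ(1 - Φ - kΨ) = 0`, `dΨ'' - cΨ' + rΨ(1 - Ψ - hΦ) = 0` on `ℝ`,
with `(Φ,Ψ)(-∞) = (0,1)` and `(Φ,Ψ)(∞) = (u*, v*)`. -/
structure IsEntireWave (d r h k c : ℝ) (Φ Ψ : ℝ → ℝ) : Prop where
  smooth_Phi : ContDiff ℝ 2 Φ
  smooth_Psi : ContDiff ℝ 2 Ψ
  ode_Phi : ∀ s : ℝ,
    deriv (deriv Φ) s - c * deriv Φ s + Φ s * (1 - Φ s - k * Ψ s) = 0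
  Phi_deriv_pos : ∀ s : ℝ, 0 < deriv Φ s
  ode_Psi : ∀ s : ℝ,
    d * deriv (deriv Ψ) s - c * deriv Ψ s + r * Ψ s * (1 - Ψ s - h * Φ s) = 0
  Psi_deriv_neg : ∀ s : ℝ, deriv Ψ s < 0
  Phi_atBot : Filter.Tendsto Φ Filter.atBot (nhds 0)
  Psi_atBot : Filter.Tendsto Ψ Filter.atBot (nhds 1)
  Phi_atTop : Filter.Tendsto Φ Filter.atTop (nhds (uStar h k))
  Psi_atTop : Filter.Tendsto Ψ Filter.atTop (nhds (vStar h k))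

lemma second_deriv_test {f f' : ℝ → ℝ} {f'' x : ℝ}
    (h1 : ∀ᶠ y in nhds x, HasDerivAt f (f' y) y) (h2 : HasDerivAt f' f'' x)
    (hm : IsLocalMax f x) : f' x = 0 ∧ f'' ≤ 0 := by
  have h0 : f' x = 0 := hm.hasDerivAt_eq_zero h1.self_of_nhds
  refine ⟨h0, ?_⟩
  have hd : deriv f =ᶠ[nhds x] f' := h1.mono fun y hy => hy.deriv
  have hdd : deriv (deriv f) x = f'' := by rw [hd.deriv_eq, h2.deriv]
  by_contra hpos
  push Not at hpos
  have hmin : IsLocalMin f x := by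
    apply isLocalMin_of_deriv_deriv_pos
    · rw [hdd]; exact hpos
    · rw [hd.self_of_nhds, h0]
    · exact h1.self_of_nhds.continuousAt
  have hc : f =ᶠ[nhds x] fun _ => f x := by
    filter_upwards [hmin, hm] with y hy1 hy2
    exact le_antisymm hy2 hy1
  have h3 : deriv f =ᶠ[nhds x] fun _ => (0:ℝ) := by
    have := hc.deriv
    simpa using this
  have h4 := h3.deriv_eq
  rw [hdd] at h4
  simp at h4
  linarith

lemma exists_max_of_tendsto {g : ℝ → ℝ} (hg : Continuous g)
    (ht : Tendsto g atTop (nhds 0)) (hb : Tendsto g atBot (nhds 0)) {x : ℝ} (hx : 0 < g x) :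
    ∃ s, 0 < g s ∧ ∀ y, g y ≤ g s := by
  have hcc : Tendsto g (cocompact ℝ) (nhds 0) := by
    rw [cocompact_eq_atBot_atTop]; exact hb.sup ht
  obtain ⟨s, hs⟩ := hg.exists_forall_ge' x ((hcc.eventually (gt_mem_nhds hx)).mono fun y hy => le_of_lt hy)
  exact ⟨s, lt_of_lt_of_le hx (hs x), hs⟩

lemma contDiff_two_hasDeriv {f : ℝ → ℝ} (hf : ContDiff ℝ 2 f) (s : ℝ) :
    HasDerivAt f (deriv f s) s ∧ HasDerivAt (deriv f) (deriv (deriv f) s) s := by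
  refine ⟨(hf.differentiable (by norm_num) s).hasDerivAt, ?_⟩
  have : ContDiff ℝ 1 (deriv f) := by
    have h2 : ContDiff ℝ (1+1) f := by simpa [one_add_one_eq_two] using hf
    exact (contDiff_succ_iff_deriv.1 h2).2.2
  exact (this.differentiable (by norm_num) s).hasDerivAt

lemma contDiffAt_two_hasDeriv {f : ℝ → ℝ} {s : ℝ} (hf : ContDiffAt ℝ 2 f s) :
    HasDerivAt f (deriv f s) s ∧ HasDerivAt (deriv f) (deriv (deriv f) s) s := by
  refine ⟨(hf.differentiableAt (by norm_num)).hasDerivAt, ?_⟩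
  have : ContDiffAt ℝ 1 (deriv f) s := by
    have h1 : ContDiffAt ℝ 1 (fderiv ℝ f) s := hf.fderiv_right (by norm_num [one_add_one_eq_two])
    exact h1.clm_apply contDiffAt_const
  exact (this.differentiableAt (by norm_num)).hasDerivAt

lemma IsEntireWave.shift {d r h k c : ℝ} {Φ Ψ : ℝ → ℝ} (H : IsEntireWave d r h k c Φ Ψ) (τ : ℝ) :
    IsEntireWave d r h k c (fun s => Φ (s + τ)) (fun s => Ψ (s + τ)) := by
  have e1 : deriv (fun s => Φ (s + τ)) = fun s => deriv Φ (s + τ) := by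
    funext s; exact deriv_comp_add_const Φ τ s
  have e2 : deriv (fun s => Ψ (s + τ)) = fun s => deriv Ψ (s + τ) := by
    funext s; exact deriv_comp_add_const Ψ τ s
  have e3 : deriv (fun s => deriv Φ (s + τ)) = fun s => deriv (deriv Φ) (s + τ) := by
    funext s; exact deriv_comp_add_const (deriv Φ) τ s
  have e4 : deriv (fun s => deriv Ψ (s + τ)) = fun s => deriv (deriv Ψ) (s + τ) := by
    funext s; exact deriv_comp_add_const (deriv Ψ) τ s
  have hT : Tendsto (fun s : ℝ => s + τ) atTop atTop := tendsto_atTop_add_const_right _ _ tendsto_id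
  have hB : Tendsto (fun s : ℝ => s + τ) atBot atBot := tendsto_atBot_add_const_right _ _ tendsto_id
  constructor
  · exact H.smooth_Phi.comp (by fun_prop)
  · exact H.smooth_Psi.comp (by fun_prop)
  · intro s; rw [e1, e3]; exact H.ode_Phi _
  · intro s; rw [e1]; exact H.Phi_deriv_pos _
  · intro s; rw [e2, e4]; exact H.ode_Psi _
  · intro s; rw [e2]; exact H.Psi_deriv_neg _
  · exact H.Phi_atBot.comp hB
  · exact H.Psi_atBot.comp hB
  · exact H.Phi_atTop.comp hT
  · exact H.Psi_atTop.comp hT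

lemma lim_bounds_mono {f : ℝ → ℝ} {a b : ℝ} (hf : StrictMono f) (hb : Tendsto f atBot (nhds a))
    (ht : Tendsto f atTop (nhds b)) (s : ℝ) : a < f s ∧ f s < b :=
  ⟨lt_of_le_of_lt (hf.monotone.le_of_tendsto hb (s-1)) (hf (by linarith)),
   lt_of_lt_of_le (hf (show s < s+1 by linarith)) (hf.monotone.ge_of_tendsto ht (s+1))⟩

lemma lim_bounds_anti {f : ℝ → ℝ} {a b : ℝ} (hf : StrictAnti f) (hb : Tendsto f atBot (nhds a))
    (ht : Tendsto f atTop (nhds b)) (s : ℝ) : b < f s ∧ f s < a :=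
  ⟨lt_of_le_of_lt (hf.antitone.le_of_tendsto ht (s+1)) (hf (by linarith)),
   lt_of_lt_of_le (hf (show s - 1 < s by linarith)) (hf.antitone.ge_of_tendsto hb (s-1))⟩

lemma IsEntireWave.bounds {d r h k c : ℝ} {Φ Ψ : ℝ → ℝ} (H : IsEntireWave d r h k c Φ Ψ) (s : ℝ) :
    (0 < Φ s ∧ Φ s < uStar h k) ∧ (vStar h k < Ψ s ∧ Ψ s < 1) :=
  ⟨lim_bounds_mono (strictMono_of_deriv_pos H.Phi_deriv_pos) H.Phi_atBot H.Phi_atTop s,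
   lim_bounds_anti (strictAnti_of_deriv_neg H.Psi_deriv_neg) H.Psi_atBot H.Psi_atTop s⟩

lemma IsSemiWave.strictMonoOn {d r h k c : ℝ} {φ ψ : ℝ → ℝ} (H : IsSemiWave d r h k c φ ψ) :
    StrictMonoOn φ (Set.Ici 0) := by
  apply strictMonoOn_of_deriv_pos (convex_Ici 0) H.cont_phi.continuousOn
  intro x hx
  rw [interior_Ici] at hx
  exact H.phi_deriv_pos x hx

lemma IsSemiWave.mono {d r h k c : ℝ} {φ ψ : ℝ → ℝ} (H : IsSemiWave d r h k c φ ψ) :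
    Monotone φ := by
  intro x y hxy
  rcases le_total x 0 with hx | hx
  · rw [H.phi_zero x hx]
    rcases le_total y 0 with hy | hy
    · rw [H.phi_zero y hy]
    · rw [← H.phi_zero 0 le_rfl]
      exact H.strictMonoOn.monotoneOn (by simp) (by simpa using hy) hy
  · exact H.strictMonoOn.monotoneOn (by simpa using hx) (by simpa using hx.trans hxy) hxy

lemma IsSemiWave.bounds {d r h k c : ℝ} {φ ψ : ℝ → ℝ} (H : IsSemiWave d r h k c φ ψ) (s : ℝ) :
    (0 ≤ φ s ∧ φ s ≤ uStar h k) ∧ (vStar h k < ψ s ∧ ψ s < 1) := by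
  refine ⟨⟨?_, H.mono.ge_of_tendsto H.phi_atTop s⟩,
    lim_bounds_anti (strictAnti_of_deriv_neg H.psi_deriv_neg) H.psi_atBot H.psi_atTop s⟩
  have := H.mono (min_le_left s 0)
  rwa [H.phi_zero _ (min_le_right s 0)] at this

lemma IsSemiWave.phi_hasDeriv {d r h k c : ℝ} {φ ψ : ℝ → ℝ} (H : IsSemiWave d r h k c φ ψ)
    {s : ℝ} (hs : 0 < s) :
    HasDerivAt φ (deriv φ s) s ∧ HasDerivAt (deriv φ) (deriv (deriv φ) s) s :=
  contDiffAt_two_hasDeriv (H.smooth_phi.contDiffAt (Ici_mem_nhds hs))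

lemma IsSemiWave.phi_lt_s8 {d r h k c : ℝ} {φ ψ : ℝ → ℝ} (H : IsSemiWave d r h k c φ ψ)
    (s : ℝ) (hu : 0 < uStar h k) : φ s < uStar h k := by
  rcases le_or_gt s 0 with hs | hs
  · rw [H.phi_zero s hs]; exact hu
  · exact lt_of_lt_of_le (H.strictMonoOn (by simpa using hs.le) (by simp; linarith)
      (show s < s + 1 by linarith)) (H.bounds _).1.2

/-- test at a local max of `φ - P` -/
lemma test_a {d r h k c : ℝ} {φ ψ P Q : ℝ → ℝ} (HS : IsSemiWave d r h k c φ ψ)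
    (HE : IsEntireWave d r h k c P Q) {s : ℝ} (hs : 0 < s)
    (hm : IsLocalMax (fun x => φ x - P x) s) :
    deriv φ s = deriv P s ∧
    0 ≤ (φ s - P s) * (1 - φ s - k * ψ s - P s) + k * P s * (Q s - ψ s) := by
  have h1 : ∀ᶠ y in nhds s, HasDerivAt (fun x => φ x - P x) (deriv φ y - deriv P y) y := by
    filter_upwards [lt_mem_nhds hs] with y hy
    exact (HS.phi_hasDeriv hy).1.sub (contDiff_two_hasDeriv HE.smooth_Phi y).1
  have h2 := (HS.phi_hasDeriv hs).2.sub (contDiff_two_hasDeriv HE.smooth_Phi s).2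
  obtain ⟨h3, h4⟩ := second_deriv_test h1 h2 hm
  have h5 : deriv φ s = deriv P s := by linarith
  refine ⟨h5, ?_⟩
  have e1 := HS.ode_phi s hs
  have e2 := HE.ode_Phi s
  rw [h5] at e1
  linarith

/-- test at a local max of `Q - ψ` -/
lemma test_b {d r h k c : ℝ} {φ ψ P Q : ℝ → ℝ} (hd : 0 < d) (hr : 0 < r)
    (HS : IsSemiWave d r h k c φ ψ)
    (HE : IsEntireWave d r h k c P Q) {s : ℝ}
    (hm : IsLocalMax (fun x => Q x - ψ x) s) :
    deriv Q s = deriv ψ s ∧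
    0 ≤ (Q s - ψ s) * (1 - ψ s - h * φ s - Q s) + h * Q s * (φ s - P s) := by
  have h1 : ∀ᶠ y in nhds s, HasDerivAt (fun x => Q x - ψ x) (deriv Q y - deriv ψ y) y :=
    Eventually.of_forall fun y =>
      (contDiff_two_hasDeriv HE.smooth_Psi y).1.sub (contDiff_two_hasDeriv HS.smooth_psi y).1
  have h2 := (contDiff_two_hasDeriv HE.smooth_Psi s).2.sub (contDiff_two_hasDeriv HS.smooth_psi s).2
  obtain ⟨h3, h4⟩ := second_deriv_test h1 h2 hm
  have h5 : deriv Q s = deriv ψ s := by linarith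
  refine ⟨h5, ?_⟩
  have e1 := HS.ode_psi s
  have e2 := HE.ode_Psi s
  rw [h5] at e2
  have h6 := mul_nonpos_of_nonneg_of_nonpos hd.le h4
  have : 0 ≤ r * ((Q s - ψ s) * (1 - ψ s - h * φ s - Q s) + h * Q s * (φ s - P s)) := by
    linarith
  exact nonneg_of_mul_nonneg_right this hr

lemma outer {d r h k c : ℝ} {φ ψ P Q : ℝ → ℝ} (hd : 0 < d) (hr : 0 < r)
    (hh : h ∈ Set.Ioo (0:ℝ) 1) (hk : k ∈ Set.Ioo (0:ℝ) 1) (hv : 0 < vStar h k)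
    (HS : IsSemiWave d r h k c φ ψ) (HE : IsEntireWave d r h k c P Q) {M : ℝ} (hM : 0 < M)
    (hA : ∀ s ≥ M, 1 - φ s - k * ψ s - (1 - k) * P s < 0)
    (hB : ∀ s ≥ M, 1 - ψ s - h * φ s - (1 - h) * vStar h k < 0)
    (hL : ∀ s ≤ -M, 1 / 2 < ψ s)
    (hin : ∀ s ∈ Set.Icc (-M) M, φ s < P s ∧ Q s < ψ s) :
    ∀ s, φ s ≤ P s ∧ Q s ≤ ψ s := by
  obtain ⟨hh0, hh1⟩ := hh
  obtain ⟨hk0, hk1⟩ := hk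
  set g : ℝ → ℝ := fun s => max (φ s - P s) (Q s - ψ s) with hg
  have hgc : Continuous g := ((HS.cont_phi.sub HE.smooth_Phi.continuous).max
    (HE.smooth_Psi.continuous.sub HS.smooth_psi.continuous))
  have hgt : Tendsto g atTop (nhds 0) := by
    have := (HS.phi_atTop.sub HE.Phi_atTop).max (HE.Psi_atTop.sub HS.psi_atTop)
    simpa using this
  have hφb : Tendsto φ atBot (nhds 0) := by
    apply tendsto_const_nhds.congr'
    filter_upwards [eventually_le_atBot (0:ℝ)] with s hs
    exact (HS.phi_zero s hs).symm
  have hgb : Tendsto g atBot (nhds 0) := by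
    have := (hφb.sub HE.Phi_atBot).max (HE.Psi_atBot.sub HS.psi_atBot)
    simpa using this
  by_contra hcon
  push Not at hcon
  obtain ⟨x, hx⟩ := hcon
  have hgx : 0 < g x := by
    by_cases h1 : φ x ≤ P x
    · exact lt_max_of_lt_right (by linarith [hx h1])
    · exact lt_max_of_lt_left (by linarith)
  obtain ⟨s, hs0, hs⟩ := exists_max_of_tendsto hgc hgt hgb hgx
  have hsM : s < -M ∨ M < s := by
    by_contra hc'
    push Not at hc'
    have := hin s hc'
    have : g s < 0 := max_lt (by linarith) (by linarith)
    linarith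
  have ha : ∀ y, φ y - P y ≤ g y := fun y => le_max_left _ _
  have hb : ∀ y, Q y - ψ y ≤ g y := fun y => le_max_right _ _
  have bE := HE.bounds s
  have bS := HS.bounds s
  rcases max_choice (φ s - P s) (Q s - ψ s) with hc1 | hc1
  · have hgs : g s = φ s - P s := hc1
    have hspos : M < s := by
      rcases hsM with h1 | h1
      · rw [HS.phi_zero s (by linarith)] at hgs
        linarith
      · exact h1
    have hm : IsLocalMax (fun x => φ x - P x) s :=
      Eventually.of_forall fun y => by
        have := ha y; have := hs y; simp only; linarith
    have ht := (test_a HS HE (hM.trans hspos) hm).2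
    have h1 := hA s hspos.le
    have h2 := hb s
    have h3 : k * P s * (Q s - ψ s) ≤ k * P s * (φ s - P s) :=
      mul_le_mul_of_nonneg_left (by linarith) (by have := mul_pos hk0 bE.1.1; linarith)
    have h4 : (φ s - P s) * (1 - φ s - k * ψ s - (1 - k) * P s) < 0 :=
      mul_neg_of_pos_of_neg (by linarith) h1
    linarith
  · have hgs : g s = Q s - ψ s := hc1
    have hm : IsLocalMax (fun x => Q x - ψ x) s :=
      Eventually.of_forall fun y => by
        have := hb y; have := hs y; simp only; linarith
    have ht := (test_b hd hr HS HE hm).2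
    have hQ : 0 < h * Q s := mul_pos hh0 (by linarith)
    rcases hsM with h1 | h1
    · have hφ := HS.phi_zero s (by linarith)
      rw [hφ] at ht
      have h2 := hL s h1.le
      have h3 : (Q s - ψ s) * (1 - ψ s - h * 0 - Q s) < 0 :=
        mul_neg_of_pos_of_neg (by linarith) (by linarith)
      have h4 := mul_pos hQ bE.1.1
      linarith
    · have h2 := hB s h1.le
      have h3 : h * Q s * (φ s - P s) ≤ h * Q s * (Q s - ψ s) :=
        mul_le_mul_of_nonneg_left (by linarith [ha s]) hQ.le
      have h5 : (1 - h) * vStar h k ≤ (1 - h) * Q s :=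
        mul_le_mul_of_nonneg_left (by linarith) (by linarith)
      have h4 : (Q s - ψ s) * (1 - ψ s - h * φ s - (1 - h) * Q s) < 0 :=
        mul_neg_of_pos_of_neg (by linarith) (by linarith)
      linarith

/-- If everything touches at a positive point we get a contradiction by ODE uniqueness. -/
lemma no_touch {d r h k c : ℝ} {φ ψ P Q : ℝ → ℝ} (hd : 0 < d)
    (HS : IsSemiWave d r h k c φ ψ) (HE : IsEntireWave d r h k c P Q) {s : ℝ} (hs : 0 < s)
    (h1 : φ s = P s) (h2 : deriv φ s = deriv P s) (h3 : Q s = ψ s)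
    (h4 : deriv Q s = deriv ψ s) : False := by
  let v : ℝ → ℝ × ℝ × ℝ × ℝ → ℝ × ℝ × ℝ × ℝ := fun _ x =>
    (x.2.1, c * x.2.1 - x.1 * (1 - x.1 - k * x.2.2.1), x.2.2.2,
      (c * x.2.2.2 - r * x.2.2.1 * (1 - x.2.2.1 - h * x.1)) / d)
  let f : ℝ → ℝ × ℝ × ℝ × ℝ := fun t => (φ t, deriv φ t, ψ t, deriv ψ t)
  let g : ℝ → ℝ × ℝ × ℝ × ℝ := fun t => (P t, deriv P t, Q t, deriv Q t)
  have hf : ∀ t > 0, HasDerivAt f (v t (f t)) t := by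
    intro t ht
    have a1 := HS.phi_hasDeriv ht
    have a2 := contDiff_two_hasDeriv HS.smooth_psi t
    have b1 : deriv (deriv φ) t = c * deriv φ t - φ t * (1 - φ t - k * ψ t) := by
      linarith [HS.ode_phi t ht]
    have b2 : deriv (deriv ψ) t = (c * deriv ψ t - r * ψ t * (1 - ψ t - h * φ t)) / d := by
      rw [eq_div_iff hd.ne']; linarith [HS.ode_psi t]
    have := a1.1.prodMk (a1.2.prodMk (a2.1.prodMk a2.2))
    rw [b1, b2] at this
    exact this
  have hg : ∀ t, HasDerivAt g (v t (g t)) t := by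
    intro t
    have a1 := contDiff_two_hasDeriv HE.smooth_Phi t
    have a2 := contDiff_two_hasDeriv HE.smooth_Psi t
    have b1 : deriv (deriv P) t = c * deriv P t - P t * (1 - P t - k * Q t) := by
      linarith [HE.ode_Phi t]
    have b2 : deriv (deriv Q) t = (c * deriv Q t - r * Q t * (1 - Q t - h * P t)) / d := by
      rw [eq_div_iff hd.ne']; linarith [HE.ode_Psi t]
    have := a1.1.prodMk (a1.2.prodMk (a2.1.prodMk a2.2))
    rw [b1, b2] at this
    exact this
  have hv : ContDiff ℝ 1 (v 0) := by
    simp only [v]; fun_prop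
  have hfg : ∀ δ, 0 < δ → δ < s → φ δ = P δ := by
    intro δ hδ hδs
    have hfc : ContinuousOn f (Set.Icc δ s) := fun t ht =>
      (hf t (lt_of_lt_of_le hδ ht.1)).continuousAt.continuousWithinAt
    have hgc : ContinuousOn g (Set.Icc δ s) := fun t ht =>
      (hg t).continuousAt.continuousWithinAt
    obtain ⟨R1, hR1⟩ := (isCompact_Icc.image_of_continuousOn hfc).isBounded.subset_closedBall 0
    obtain ⟨R2, hR2⟩ := (isCompact_Icc.image_of_continuousOn hgc).isBounded.subset_closedBall 0
    set B := Metric.closedBall (0 : ℝ × ℝ × ℝ × ℝ) (max R1 R2)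
    obtain ⟨K, hK⟩ := (hv.locallyLipschitz.locallyLipschitzOn (s := B)).exists_lipschitzOnWith_of_compact
      (isCompact_closedBall _ _)
    have := ODE_solution_unique_of_mem_Icc_left (v := v) (s := fun _ => B) (K := K)
      (f := f) (g := g) (a := δ) (b := s) (fun t _ => hK) hfc
      (fun t ht => (hf t (hδ.trans ht.1)).hasDerivWithinAt)
      (fun t ht => Metric.closedBall_subset_closedBall (le_max_left _ _)
        (hR1 (mem_image_of_mem f (Ioc_subset_Icc_self ht))))
      hgc (fun t ht => (hg t).hasDerivWithinAt)
      (fun t ht => Metric.closedBall_subset_closedBall (le_max_right _ _)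
        (hR2 (mem_image_of_mem g (Ioc_subset_Icc_self ht))))
      (by simp only [f, g]; rw [h1, h2, h3, h4])
    exact congrArg Prod.fst (this ⟨le_rfl, hδs.le⟩)
  have hl : Tendsto (fun x => φ x - P x) (nhdsWithin 0 (Set.Ioi 0)) (nhds (φ 0 - P 0)) :=
    ((HS.cont_phi.sub HE.smooth_Phi.continuous).tendsto 0).mono_left nhdsWithin_le_nhds
  have hl2 : Tendsto (fun x => φ x - P x) (nhdsWithin 0 (Set.Ioi 0)) (nhds 0) := by
    apply tendsto_const_nhds.congr'
    filter_upwards [Ioo_mem_nhdsGT hs] with x hx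
    rw [hfg x hx.1 hx.2, sub_self]
  have := tendsto_nhds_unique hl hl2
  rw [HS.phi_zero 0 le_rfl] at this
  linarith [(HE.bounds 0).1.1]

lemma strict {d r h k c : ℝ} {φ ψ P Q : ℝ → ℝ} (hd : 0 < d) (hr : 0 < r)
    (hh : h ∈ Set.Ioo (0:ℝ) 1) (hk : k ∈ Set.Ioo (0:ℝ) 1) (hv : 0 < vStar h k)
    (HS : IsSemiWave d r h k c φ ψ) (HE : IsEntireWave d r h k c P Q)
    (hle : ∀ s, φ s ≤ P s ∧ Q s ≤ ψ s) (s : ℝ) : φ s < P s ∧ Q s < ψ s := by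
  have bE := HE.bounds s
  have key : ¬ (φ s = P s ∧ Q s = ψ s) := by
    rintro ⟨h1, h2⟩
    have hs : 0 < s := by
      by_contra hs
      rw [HS.phi_zero s (by linarith)] at h1
      linarith
    have m1 : IsLocalMax (fun x => φ x - P x) s :=
      Eventually.of_forall fun y => by have := (hle y).1; simp only; linarith
    have m2 : IsLocalMax (fun x => Q x - ψ x) s :=
      Eventually.of_forall fun y => by have := (hle y).2; simp only; linarith
    exact no_touch hd HS HE hs h1 (test_a HS HE hs m1).1 h2 (test_b hd hr HS HE m2).1
  constructor
  · refine lt_of_le_of_ne (hle s).1 fun h1 => key ⟨h1, ?_⟩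
    have hs : 0 < s := by
      by_contra hs
      rw [HS.phi_zero s (by linarith)] at h1
      linarith
    have m1 : IsLocalMax (fun x => φ x - P x) s :=
      Eventually.of_forall fun y => by have := (hle y).1; simp only; linarith
    have ht := (test_a HS HE hs m1).2
    rw [h1, sub_self, zero_mul, zero_add] at ht
    have := nonneg_of_mul_nonneg_right ht (mul_pos hk.1 bE.1.1)
    linarith [(hle s).2]
  · refine lt_of_le_of_ne (hle s).2 fun h1 => key ⟨?_, h1⟩
    have m2 : IsLocalMax (fun x => Q x - ψ x) s :=
      Eventually.of_forall fun y => by have := (hle y).2; simp only; linarith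
    have ht := (test_b hd hr HS HE m2).2
    rw [h1, sub_self, zero_mul, zero_add, ← h1] at ht
    have := nonneg_of_mul_nonneg_right ht (mul_pos hh.1 (hv.trans bE.2.1))
    linarith [(hle s).1]

lemma outer_uniform {d r h k c : ℝ} {φ ψ Φ Ψ : ℝ → ℝ} (hd : 0 < d) (hr : 0 < r)
    (hh : h ∈ Set.Ioo (0:ℝ) 1) (hk : k ∈ Set.Ioo (0:ℝ) 1) (hv : 0 < vStar h k)
    (hu : 0 < uStar h k) (e1 : uStar h k + k * vStar h k = 1) (e2 : vStar h k + h * uStar h k = 1)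
    (HS : IsSemiWave d r h k c φ ψ) (HE : IsEntireWave d r h k c Φ Ψ) (τ₀ : ℝ) :
    ∃ M : ℝ, 0 < M ∧ ∀ τ ≥ τ₀,
      (∀ s ∈ Set.Icc (-M) M, φ s < Φ (s + τ) ∧ Ψ (s + τ) < ψ s) →
      ∀ s, φ s ≤ Φ (s + τ) ∧ Ψ (s + τ) ≤ ψ s := by
  have HE0 := HE.shift τ₀
  have hk1 : 0 < 1 - k := by linarith [hk.2]
  have hh1 : 0 < 1 - h := by linarith [hh.2]
  have t1 : Tendsto (fun s => 1 - φ s - k * ψ s - (1 - k) * Φ (s + τ₀)) atTop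
      (nhds (1 - uStar h k - k * vStar h k - (1 - k) * uStar h k)) :=
    ((tendsto_const_nhds.sub HS.phi_atTop).sub (HS.psi_atTop.const_mul k)).sub
      (HE0.Phi_atTop.const_mul _)
  have t2 : Tendsto (fun s => 1 - ψ s - h * φ s - (1 - h) * vStar h k) atTop
      (nhds (1 - vStar h k - h * uStar h k - (1 - h) * vStar h k)) :=
    ((tendsto_const_nhds.sub HS.psi_atTop).sub (HS.phi_atTop.const_mul h)).sub
      tendsto_const_nhds
  have n1 := t1.eventually (gt_mem_nhds (show _ < (0:ℝ) by have := mul_pos hk1 hu; linarith))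
  have n2 := t2.eventually (gt_mem_nhds (show _ < (0:ℝ) by have := mul_pos hh1 hv; linarith))
  have n3 := HS.psi_atBot.eventually (lt_mem_nhds (show (1/2:ℝ) < 1 by norm_num))
  obtain ⟨M1, hM1⟩ := eventually_atTop.1 n1
  obtain ⟨M2, hM2⟩ := eventually_atTop.1 n2
  obtain ⟨M3, hM3⟩ := eventually_atBot.1 n3
  have hmono := (strictMono_of_deriv_pos HE.Phi_deriv_pos).monotone
  refine ⟨max 1 (max M1 (max M2 (-M3))), by positivity, fun τ hτ hin => ?_⟩
  have i0 := le_max_left 1 (max M1 (max M2 (-M3)))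
  have i1 := le_max_right 1 (max M1 (max M2 (-M3)))
  have i2 := le_max_left M1 (max M2 (-M3))
  have i3 := le_max_right M1 (max M2 (-M3))
  have i4 := le_max_left M2 (-M3)
  have i5 := le_max_right M2 (-M3)
  refine outer (M := max 1 (max M1 (max M2 (-M3)))) hd hr hh hk hv HS (HE.shift τ)
    (by linarith) ?_ ?_ ?_ hin
  · intro s hs
    have a := hM1 s (by linarith)
    have b := mul_le_mul_of_nonneg_left (hmono (show s + τ₀ ≤ s + τ by linarith)) hk1.le
    linarith
  · intro s hs; exact hM2 s (by linarith)
  · intro s hs; exact hM3 s (by linarith)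

theorem stmt8 (d r h k c : ℝ) (hd : 0 < d) (hr : 0 < r)
    (hh : h ∈ Set.Ioo (0:ℝ) 1) (hk : k ∈ Set.Ioo (0:ℝ) 1) (hc : 0 ≤ c)
    (hentire : ∃ Φ Ψ : ℝ → ℝ, IsEntireWave d r h k c Φ Ψ) :
    ¬ ∃ φ ψ : ℝ → ℝ, IsSemiWave d r h k c φ ψ := by
  rintro ⟨φ, ψ, HS⟩
  obtain ⟨Φ, Ψ, HE⟩ := hentire
  have hkh : 0 < 1 - h * k := by nlinarith [hh.1, hh.2, hk.1, hk.2]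
  have hu : 0 < uStar h k := div_pos (by linarith [hk.2]) hkh
  have hv : 0 < vStar h k := div_pos (by linarith [hh.2]) hkh
  have e1 : uStar h k + k * vStar h k = 1 := by
    unfold uStar vStar
    rw [← mul_div_assoc, ← add_div, div_eq_one_iff_eq hkh.ne']; ring
  have e2 : vStar h k + h * uStar h k = 1 := by
    unfold uStar vStar
    rw [← mul_div_assoc, ← add_div, div_eq_one_iff_eq hkh.ne']; ring
  have hΦm := strictMono_of_deriv_pos HE.Phi_deriv_pos
  have hΨm := strictAnti_of_deriv_neg HE.Psi_deriv_neg
  have hψm := strictAnti_of_deriv_neg HS.psi_deriv_neg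
  have hΦc := HE.smooth_Phi.continuous
  have hΨc := HE.smooth_Psi.continuous
  have hφc := HS.cont_phi
  have hψc := HS.smooth_psi.continuous
  let S : Set ℝ := {τ | ∀ s, φ s ≤ Φ (s + τ) ∧ Ψ (s + τ) ≤ ψ s}
  have hne : S.Nonempty := by
    obtain ⟨M, hM, H⟩ := outer_uniform hd hr hh hk hv hu e1 e2 HS HE 0
    have n1 := HE.Phi_atTop.eventually (lt_mem_nhds (HS.phi_lt_s8 M hu))
    have n2 := HE.Psi_atTop.eventually (gt_mem_nhds (HS.bounds M).2.1)
    obtain ⟨T, hT1, hT2, hT3⟩ := (n1.and (n2.and (eventually_ge_atTop (0:ℝ)))).exists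
    refine ⟨T + M, H (T + M) (by linarith) fun s hs => ⟨?_, ?_⟩⟩
    · calc φ s ≤ φ M := HS.mono hs.2
        _ < Φ T := hT1
        _ ≤ Φ (s + (T + M)) := hΦm.monotone (by linarith [hs.1])
    · calc Ψ (s + (T + M)) ≤ Ψ T := hΨm.antitone (by linarith [hs.1])
        _ < ψ M := hT2
        _ ≤ ψ s := hψm.antitone hs.2
  have hbdd : BddBelow S := by
    have hφ1 : 0 < φ 1 := by
      have := HS.strictMonoOn (show (0:ℝ) ∈ Set.Ici 0 by simp) (show (1:ℝ) ∈ Set.Ici 0 by simp)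
        one_pos
      rwa [HS.phi_zero 0 le_rfl] at this
    obtain ⟨T, hT⟩ := eventually_atBot.1 (HE.Phi_atBot.eventually (gt_mem_nhds hφ1))
    refine ⟨T - 1, fun τ hτ => ?_⟩
    by_contra hlt
    have a := hT (1 + τ) (by linarith)
    have b := (hτ 1).1
    linarith
  have hclosed : IsClosed S := by
    have : S = ⋂ s, {τ | φ s ≤ Φ (s + τ)} ∩ {τ | Ψ (s + τ) ≤ ψ s} := by
      ext τ; simp [S]
    rw [this]
    exact isClosed_iInter fun s => (isClosed_le (by fun_prop) (by fun_prop)).inter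
      (isClosed_le (by fun_prop) (by fun_prop))
  set t := sInf S
  have ht : t ∈ S := hclosed.csInf_mem hne hbdd
  have hst := strict hd hr hh hk hv HS (HE.shift t) ht
  obtain ⟨M, hM, H⟩ := outer_uniform hd hr hh hk hv hu e1 e2 HS HE (t - 1)
  have hev : ∀ᶠ τ in nhds t, ∀ s ∈ Set.Icc (-M) M, φ s < Φ (s + τ) ∧ Ψ (s + τ) < ψ s := by
    apply isCompact_Icc.eventually_forall_of_forall_eventually
    intro s _
    have o : IsOpen {p : ℝ × ℝ | φ p.2 < Φ (p.2 + p.1) ∧ Ψ (p.2 + p.1) < ψ p.2} :=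
      IsOpen.and (isOpen_lt (by fun_prop) (by fun_prop)) (isOpen_lt (by fun_prop) (by fun_prop))
    exact o.mem_nhds (hst s)
  obtain ⟨ε, hε, hball⟩ := Metric.eventually_nhds_iff.1 hev
  have hmin : 0 < min (ε / 2) 1 := by positivity
  have hin := @hball (t - min (ε / 2) 1) (by
    rw [Real.dist_eq, sub_sub_cancel_left, abs_neg, abs_of_pos hmin]
    linarith [min_le_left (ε / 2) 1])
  have hmem : t - min (ε / 2) 1 ∈ S := H _ (by linarith [min_le_right (ε / 2) 1]) hin
  have := csInf_le hbdd hmem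
  linarith
end

section
/- Fix constants d, r > 0 and h, k ∈ (0,1), and set u* = (1-k)/(1-hk). If there exists a semi-wave with speed c ≥ 0, then c ≤ 2√(u*). -/
open Real Filter Set

lemma exp_mono_aux (w : ℝ → ℝ) (l : ℝ) (hw : ∀ s > (0:ℝ), DifferentiableAt ℝ w s)
    (hi : ∀ s > (0:ℝ), 0 ≤ deriv w s - l * w s) :
    MonotoneOn (fun s => w s * Real.exp (-l * s)) (Set.Ioi 0) := by
  have hd : ∀ s > (0:ℝ), HasDerivAt (fun s => w s * Real.exp (-l * s))
      (deriv w s * Real.exp (-l * s) + w s * (Real.exp (-l * s) * (-l * 1))) s := by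
    intro s hs
    exact (hw s hs).hasDerivAt.mul (((hasDerivAt_id s).const_mul (-l)).exp)
  apply monotoneOn_of_deriv_nonneg (convex_Ioi 0)
  · intro s hs
    exact (hd s hs).continuousAt.continuousWithinAt
  · intro s hs
    rw [interior_Ioi] at hs
    exact (hd s hs).differentiableAt.differentiableWithinAt
  · intro s hs
    rw [interior_Ioi] at hs
    rw [(hd s hs).deriv]
    have := mul_nonneg (hi s hs) (Real.exp_pos (-l * s)).le
    linarith

theorem stmt9 (d r h k c : ℝ) (hd : 0 < d) (hr : 0 < r)
    (hh : h ∈ Set.Ioo (0:ℝ) 1) (hk : k ∈ Set.Ioo (0:ℝ) 1) (hc : 0 ≤ c)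
    (hex : ∃ φ ψ : ℝ → ℝ, IsSemiWave d r h k c φ ψ) :
    c ≤ 2 * Real.sqrt (uStar h k) := by
  obtain ⟨φ, ψ, H⟩ := hex
  obtain ⟨hh0, hh1⟩ := hh
  obtain ⟨hk0, hk1⟩ := hk
  by_contra hlt
  push Not at hlt
  have hhk : 0 < 1 - h * k := by nlinarith
  have hu : 0 < uStar h k := div_pos (by linarith) hhk
  have huv : uStar h k + k * vStar h k = 1 := by
    unfold uStar vStar
    rw [← mul_div_assoc, ← add_div, div_eq_one_iff_eq hhk.ne']
    ring
  set u := uStar h k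
  have hsq : 4 * u < c ^ 2 := by
    have h1 := Real.sq_sqrt hu.le
    have h2 := Real.sqrt_nonneg u
    nlinarith
  -- the characteristic roots
  obtain ⟨a, b, ha, hab, hmul⟩ : ∃ a b : ℝ, 0 < a ∧ a + b = c ∧ a * b = u := by
    have h1 : 0 ≤ c ^ 2 - 4 * u := by linarith
    have h2 := Real.sq_sqrt h1
    have h3 := Real.sqrt_nonneg (c ^ 2 - 4 * u)
    refine ⟨(c - √(c ^ 2 - 4 * u)) / 2, (c + √(c ^ 2 - 4 * u)) / 2, ?_, by ring, by nlinarith⟩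
    have : √(c ^ 2 - 4 * u) < c := by
      by_contra hcon
      push Not at hcon
      nlinarith
    linarith
  have hcd : ContDiffOn ℝ 2 φ (Set.Ioi 0) := H.smooth_phi.mono Set.Ioi_subset_Ici_self
  have hdφ : ∀ s > (0:ℝ), DifferentiableAt ℝ φ s := fun s hs =>
    (hcd.differentiableOn (by norm_num)).differentiableAt (Ioi_mem_nhds hs)
  have hddφ : ∀ s > (0:ℝ), DifferentiableAt ℝ (deriv φ) s := fun s hs =>
    ((hcd.deriv_of_isOpen (m := 1) isOpen_Ioi (by norm_num)).differentiableOn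
      (by norm_num)).differentiableAt (Ioi_mem_nhds hs)
  have hψanti : Antitone ψ := (strictAnti_of_deriv_neg H.psi_deriv_neg).antitone
  have hψ : ∀ s, vStar h k ≤ ψ s := fun s => hψanti.le_of_tendsto H.psi_atTop s
  have hφmono : StrictMonoOn φ (Set.Ici 0) := by
    apply strictMonoOn_of_deriv_pos (convex_Ici 0) H.cont_phi.continuousOn
    intro s hs
    rw [interior_Ici] at hs
    exact H.phi_deriv_pos s hs
  have hφ0 : φ 0 = 0 := H.phi_zero 0 le_rfl
  have hφpos : ∀ s > (0:ℝ), 0 < φ s := fun s hs => by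
    have := hφmono (Set.mem_Ici.2 le_rfl) (Set.mem_Ici.2 hs.le) hs
    linarith
  -- first-order factor
  have hm1 := exp_mono_aux (fun s => deriv φ s - a * φ s) b
    (fun s hs => (hddφ s hs).sub ((hdφ s hs).const_mul a)) (by
      intro s hs
      have hder : deriv (fun s => deriv φ s - a * φ s) s
          = deriv (deriv φ) s - a * deriv φ s :=
        ((hddφ s hs).hasDerivAt.sub ((hdφ s hs).hasDerivAt.const_mul a)).deriv
      rw [hder]
      have e := H.ode_phi s hs
      have p := hφpos s hs
      have q : 0 ≤ φ s * (k * (ψ s - vStar h k)) :=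
        mul_nonneg p.le (mul_nonneg hk0.le (by linarith [hψ s]))
      have e2 : deriv (deriv φ) s - a * deriv φ s - b * (deriv φ s - a * φ s)
          = φ s * φ s + φ s * (k * (ψ s - vStar h k)) := by
        have h1 : (1:ℝ) = a * b + k * vStar h k := by rw [hmul]; exact huv.symm
        have e3 : deriv (deriv φ) s = (a + b) * deriv φ s
            - φ s * (a * b + k * vStar h k - φ s - k * ψ s) := by
          rw [hab, ← h1]; linarith
        rw [e3]; ring
      show 0 ≤ deriv (deriv φ) s - a * deriv φ s - b * (deriv φ s - a * φ s)
      rw [e2]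
      nlinarith)
  have hw : ∀ s > (0:ℝ), 0 ≤ deriv φ s - a * φ s := by
    intro s hs
    have hlim : Tendsto (fun t => -(a * φ t) * Real.exp (-b * t)) (nhdsWithin 0 (Set.Ioi 0))
        (nhds 0) := by
      have hc' : Continuous (fun t => -(a * φ t) * Real.exp (-b * t)) := by
        have := H.cont_phi
        fun_prop
      have := hc'.tendsto 0
      simp only [hφ0, mul_zero, neg_zero, zero_mul] at this
      exact this.mono_left nhdsWithin_le_nhds
    have hle : (0:ℝ) ≤ (deriv φ s - a * φ s) * Real.exp (-b * s) := by
      apply le_of_tendsto hlim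
      filter_upwards [Ioo_mem_nhdsGT hs] with t ht
      have h1 := hm1 (Set.mem_Ioi.2 ht.1) (Set.mem_Ioi.2 hs) ht.2.le
      simp only at h1
      refine le_trans ?_ h1
      apply mul_le_mul_of_nonneg_right _ (Real.exp_pos _).le
      linarith [H.phi_deriv_pos t ht.1]
    exact nonneg_of_mul_nonneg_left hle (Real.exp_pos _)
  have hm2 := exp_mono_aux φ a hdφ hw
  -- exponential growth contradicts convergence
  have hdecay : Tendsto (fun s => φ s * Real.exp (-a * s)) atTop (nhds 0) := by
    have h1 : Tendsto (fun s : ℝ => Real.exp (-a * s)) atTop (nhds 0) :=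
      Real.tendsto_exp_atBot.comp
        (tendsto_id.const_mul_atTop_of_neg (neg_lt_zero.2 ha))
    simpa using H.phi_atTop.mul h1
  have hge : φ 1 * Real.exp (-a * 1) ≤ 0 := by
    apply ge_of_tendsto hdecay
    filter_upwards [eventually_ge_atTop (1:ℝ)] with s hs
    exact hm2 (Set.mem_Ioi.2 one_pos) (Set.mem_Ioi.2 (by linarith)) hs
  have := mul_pos (hφpos 1 one_pos) (Real.exp_pos (-a * 1))
  linarith
end

section
/- Fix constants d, r > 0 and h, k ∈ (0,1). Suppose 0 ≤ c₁ < c₂, (φ₁, ψ₁) is a semi-wave with speed c₁, and (φ₂, ψ₂) is a semi-wave with speed c₂. Then the right derivatives at 0 satisfy φ₁'(0⁺) > φ₂'(0⁺), φ₁(s) > φ₂(s) for all s > 0, and ψ₁(s) < ψ₂(s) for all s ∈ ℝ. -/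
open Real Filter Set

lemma min_second {f f1 : ℝ → ℝ} {m s : ℝ} (h1 : ∀ᶠ x in nhds s, HasDerivAt f (f1 x) x)
    (h2 : HasDerivAt f1 m s) (hm : IsLocalMin f s) : f1 s = 0 ∧ 0 ≤ m := by
  have e : deriv f =ᶠ[nhds s] f1 := by
    filter_upwards [h1] with x hx using hx.deriv
  have h0 : f1 s = 0 := by rw [← h1.self_of_nhds.deriv]; exact hm.deriv_eq_zero
  refine ⟨h0, ?_⟩
  by_contra hneg
  push Not at hneg
  have e2 : deriv (deriv f) s = m := by rw [e.deriv_eq]; exact h2.deriv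
  have hM : IsLocalMax f s := isLocalMax_of_deriv_deriv_neg (by rw [e2]; exact hneg)
    (by rw [e.self_of_nhds]; exact h0) h1.self_of_nhds.continuousAt
  have hc : f =ᶠ[nhds s] fun _ => f s := by
    filter_upwards [hm, hM] with x a b using le_antisymm b a
  have : deriv (deriv f) s = 0 := by
    rw [hc.deriv.deriv_eq]; simp
  linarith

lemma hopf {f f1 f2 : ℝ → ℝ} {c δ : ℝ} (hδ : 0 < δ) (hf : ContinuousOn f (Ici 0))
    (hf1 : ContinuousOn f1 (Ici 0)) (h1 : ∀ s > 0, HasDerivAt f (f1 s) s)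
    (h2 : ∀ s > 0, HasDerivAt f1 (f2 s) s) (h0 : f 0 = 0) (h10 : f1 0 ≤ 0)
    (hneg : ∀ s > 0, s < δ → f2 s - c * f1 s < 0) : ∃ s > 0, f s < 0 := by
  have sub : Icc 0 δ ⊆ Ici (0:ℝ) := fun x hx => hx.1
  have A : StrictAntiOn (fun s => f1 s - c * f s) (Icc 0 δ) := by
    apply strictAntiOn_of_deriv_neg (convex_Icc 0 δ)
    · exact (hf1.mono sub).sub (continuousOn_const.mul (hf.mono sub))
    · intro x hx
      rw [interior_Icc] at hx
      have e : HasDerivAt (fun s => f1 s - c * f s) (f2 x - c * f1 x) x :=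
        (h2 x hx.1).sub ((h1 x hx.1).const_mul c)
      rw [e.deriv]
      exact hneg x hx.1 hx.2
  have B : ∀ s > 0, s < δ → f1 s - c * f s < 0 := by
    intro s hs hsd
    have := A (left_mem_Icc.2 hδ.le) ⟨hs.le, hsd.le⟩ hs
    simp only [h0] at this
    linarith
  have C : StrictAntiOn (fun s => Real.exp (-c * s) * f s) (Icc 0 δ) := by
    apply strictAntiOn_of_deriv_neg (convex_Icc 0 δ)
    · exact (by fun_prop : Continuous fun s => Real.exp (-c * s)).continuousOn.mul (hf.mono sub)
    · intro x hx
      rw [interior_Icc] at hx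
      have e : HasDerivAt (fun s => Real.exp (-c * s)) (Real.exp (-c * x) * (-c)) x := by
        simpa using ((hasDerivAt_id x).const_mul (-c)).exp
      have e' : HasDerivAt (fun s => Real.exp (-c * s) * f s)
          (Real.exp (-c * x) * (-c) * f x + Real.exp (-c * x) * f1 x) x := e.mul (h1 x hx.1)
      rw [e'.deriv]
      have := B x hx.1 hx.2
      have := Real.exp_pos (-c * x)
      nlinarith
  refine ⟨δ, hδ, ?_⟩
  have := C (left_mem_Icc.2 hδ.le) (right_mem_Icc.2 hδ.le) hδ
  simp only [h0, mul_zero] at this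
  have := Real.exp_pos (-c * δ)
  by_contra hh
  push Not at hh
  nlinarith

section basics
variable {d r h k c : ℝ} {φ ψ : ℝ → ℝ}

lemma sw_d1 (H : IsSemiWave d r h k c φ ψ) (s : ℝ) (hs : 0 < s) :
    HasDerivAt φ (deriv φ s) s := by
  have := (H.smooth_phi.contDiffAt (Ici_mem_nhds hs)).differentiableAt (by norm_num)
  exact this.hasDerivAt

lemma sw_d2 (H : IsSemiWave d r h k c φ ψ) (s : ℝ) (hs : 0 < s) :
    HasDerivAt (deriv φ) (deriv (deriv φ) s) s := by
  have h1 : ContDiffOn ℝ 2 φ (Ioi 0) := H.smooth_phi.mono Ioi_subset_Ici_self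
  have h2 : ContDiffOn ℝ 1 (deriv φ) (Ioi 0) := h1.deriv_of_isOpen isOpen_Ioi (by norm_num)
  exact ((h2.contDiffAt (Ioi_mem_nhds hs)).differentiableAt (by norm_num)).hasDerivAt

lemma sw_e1 (H : IsSemiWave d r h k c φ ψ) (s : ℝ) : HasDerivAt ψ (deriv ψ s) s :=
  (H.smooth_psi.differentiable (by norm_num) s).hasDerivAt

lemma sw_e2 (H : IsSemiWave d r h k c φ ψ) (s : ℝ) :
    HasDerivAt (deriv ψ) (deriv (deriv ψ) s) s := by
  have h2 : ContDiff ℝ 1 (deriv ψ) :=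
    by
    have e : (2 : WithTop ℕ∞) = 1 + 1 := by norm_num
    have h3 := H.smooth_psi
    rw [e, contDiff_succ_iff_deriv] at h3
    exact h3.2.2
  exact (h2.differentiable (by norm_num) s).hasDerivAt

lemma sw_smono (H : IsSemiWave d r h k c φ ψ) : StrictMonoOn φ (Ici 0) := by
  apply strictMonoOn_of_deriv_pos (convex_Ici 0) H.cont_phi.continuousOn
  intro x hx
  rw [interior_Ici] at hx
  exact H.phi_deriv_pos x hx

lemma sw_pos (H : IsSemiWave d r h k c φ ψ) (s : ℝ) (hs : 0 < s) : 0 < φ s := by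
  have := sw_smono H (by simp) (mem_Ici.2 hs.le) hs
  rwa [H.phi_zero 0 le_rfl] at this

lemma sw_mono (H : IsSemiWave d r h k c φ ψ) : Monotone φ := by
  intro x y hxy
  rcases le_or_gt y 0 with hy | hy
  · rw [H.phi_zero x (hxy.trans hy), H.phi_zero y hy]
  · rcases le_or_gt x 0 with hx | hx
    · rw [H.phi_zero x hx]; exact (sw_pos H y hy).le
    · exact (sw_smono H).monotoneOn (mem_Ici.2 hx.le) (mem_Ici.2 hy.le) hxy

lemma sw_nonneg (H : IsSemiWave d r h k c φ ψ) (s : ℝ) : 0 ≤ φ s := by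
  rcases le_or_gt s 0 with hs | hs
  · rw [H.phi_zero s hs]
  · exact (sw_pos H s hs).le

lemma sw_anti (H : IsSemiWave d r h k c φ ψ) : StrictAnti ψ :=
  strictAnti_of_deriv_neg H.psi_deriv_neg

lemma sw_lt (H : IsSemiWave d r h k c φ ψ) (s : ℝ) : φ s < uStar h k := by
  have h1 : φ s < φ (max s 0 + 1) := by
    calc φ s ≤ φ (max s 0) := sw_mono H (le_max_left _ _)
      _ < _ := sw_smono H (mem_Ici.2 (le_max_right _ _))
        (mem_Ici.2 (by have := le_max_right s 0; linarith)) (by linarith)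
  exact h1.trans_le ((sw_mono H).ge_of_tendsto H.phi_atTop _)

lemma sw_gt (H : IsSemiWave d r h k c φ ψ) (s : ℝ) : vStar h k < ψ s :=
  ((sw_anti H).antitone.le_of_tendsto H.psi_atTop (s + 1)).trans_lt
    (sw_anti H (by linarith))

lemma sw_lt_one (H : IsSemiWave d r h k c φ ψ) (s : ℝ) : ψ s < 1 :=
  (sw_anti H (by linarith : s - 1 < s)).trans_le
    (ge_of_tendsto H.psi_atBot (by
      filter_upwards [eventually_le_atBot (s - 1)] with t ht using (sw_anti H).antitone ht))

lemma sw_psi_pos (hh : h ∈ Ioo (0:ℝ) 1) (hk : k ∈ Ioo (0:ℝ) 1)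
    (H : IsSemiWave d r h k c φ ψ) (s : ℝ) : 0 < ψ s := by
  refine lt_trans ?_ (sw_gt H s)
  unfold vStar
  have := hh.1; have := hh.2; have := hk.1; have := hk.2
  apply div_pos <;> nlinarith

lemma sw_dw (H : IsSemiWave d r h k c φ ψ) (s : ℝ) (hs : 0 < s) :
    derivWithin φ (Ici 0) s = deriv φ s :=
  derivWithin_of_mem_nhds (Ici_mem_nhds hs)

lemma sw_dwc (H : IsSemiWave d r h k c φ ψ) :
    ContinuousOn (derivWithin φ (Ici 0)) (Ici 0) :=
  H.smooth_phi.continuousOn_derivWithin (uniqueDiffOn_Ici 0) (by norm_num)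

lemma sw_dw2 (H : IsSemiWave d r h k c φ ψ) (s : ℝ) (hs : 0 < s) :
    HasDerivAt (derivWithin φ (Ici 0)) (deriv (deriv φ) s) s := by
  refine (sw_d2 H s hs).congr_of_eventuallyEq ?_
  filter_upwards [Ioi_mem_nhds hs] with x hx using sw_dw H x hx

lemma sw_dw_pos (hh : h ∈ Ioo (0:ℝ) 1) (hk : k ∈ Ioo (0:ℝ) 1)
    (H : IsSemiWave d r h k c φ ψ) : 0 < derivWithin φ (Ici 0) 0 := by
  by_contra hcon
  push Not at hcon
  have hlim : ∀ᶠ s in nhds (0:ℝ), 0 < 1 - φ s - k * ψ s := by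
    have hc : Continuous fun s => 1 - φ s - k * ψ s := by
      have := H.cont_phi; have := H.smooth_psi.continuous
      fun_prop
    apply hc.continuousAt.eventually (lt_mem_nhds _)
    show 0 < 1 - φ 0 - k * ψ 0
    rw [H.phi_zero 0 le_rfl]
    have := sw_lt_one H 0
    have := hk.1; have := hk.2
    nlinarith
  obtain ⟨δ, hδ, hb⟩ := Metric.eventually_nhds_iff.1 hlim
  obtain ⟨s, hs, hn⟩ := hopf (c := c) hδ H.cont_phi.continuousOn (sw_dwc H)
    (fun s hs => by rw [sw_dw H s hs]; exact sw_d1 H s hs) (sw_dw2 H) (H.phi_zero 0 le_rfl) hcon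
    (by
      intro s hs hsd
      rw [sw_dw H s hs]
      have h1 := hb (y := s) (by rw [Real.dist_eq, sub_zero, abs_of_pos hs]; exact hsd)
      have h2 := H.ode_phi s hs
      have := mul_pos (sw_pos H s hs) h1
      linarith)
  exact absurd (sw_pos H s hs) (not_lt.2 hn.le)
end basics

section compare
variable {d r h k c₁ c₂ : ℝ} {φ₁ ψ₁ φ₂ ψ₂ : ℝ → ℝ}

lemma touch_w (hc : c₁ < c₂) (H₁ : IsSemiWave d r h k c₁ φ₁ ψ₁)
    (H₂ : IsSemiWave d r h k c₂ φ₂ ψ₂) {τ s : ℝ} (hτ : 0 ≤ τ) (hs : 0 < s)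
    (hm : ∀ t, φ₁ (s + τ) - φ₂ s ≤ φ₁ (t + τ) - φ₂ t) :
    φ₁ (s + τ) * (1 - φ₁ (s + τ) - k * ψ₁ (s + τ)) < φ₂ s * (1 - φ₂ s - k * ψ₂ s) := by
  obtain ⟨a, b⟩ := min_second (f := fun t => φ₁ (t + τ) - φ₂ t)
    (f1 := fun t => deriv φ₁ (t + τ) - deriv φ₂ t) (s := s)
    (by
      filter_upwards [Ioi_mem_nhds hs] with x hx
      have hx : 0 < x := hx
      exact (sw_d1 H₁ (x + τ) (by linarith)).comp_add_const x τ |>.sub (sw_d1 H₂ x hx))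
    (((sw_d2 H₁ (s + τ) (by linarith)).comp_add_const s τ).sub (sw_d2 H₂ s hs))
    (Filter.Eventually.of_forall hm)
  have e1 := H₁.ode_phi (s + τ) (by linarith)
  have e2 := H₂.ode_phi s hs
  have p := H₂.phi_deriv_pos s hs
  have a' : deriv φ₁ (s + τ) = deriv φ₂ s := by linarith
  rw [a'] at e1
  nlinarith

lemma touch_z (hd : 0 < d) (hr : 0 < r) (hc : c₁ < c₂) (H₁ : IsSemiWave d r h k c₁ φ₁ ψ₁)
    (H₂ : IsSemiWave d r h k c₂ φ₂ ψ₂) {τ s : ℝ}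
    (hm : ∀ t, ψ₂ s - ψ₁ (s + τ) ≤ ψ₂ t - ψ₁ (t + τ)) :
    ψ₂ s * (1 - ψ₂ s - h * φ₂ s) < ψ₁ (s + τ) * (1 - ψ₁ (s + τ) - h * φ₁ (s + τ)) := by
  obtain ⟨a, b⟩ := min_second (f := fun t => ψ₂ t - ψ₁ (t + τ))
    (f1 := fun t => deriv ψ₂ t - deriv ψ₁ (t + τ)) (s := s)
    (Filter.Eventually.of_forall fun x =>
      (sw_e1 H₂ x).sub ((sw_e1 H₁ (x + τ)).comp_add_const x τ))
    ((sw_e2 H₂ s).sub ((sw_e2 H₁ (s + τ)).comp_add_const s τ))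
    (Filter.Eventually.of_forall hm)
  have e1 := H₁.ode_psi (s + τ)
  have e2 := H₂.ode_psi s
  have p := H₂.psi_deriv_neg s
  have a' : deriv ψ₁ (s + τ) = deriv ψ₂ s := by linarith
  rw [a'] at e1
  have q := mul_nonneg hd.le b
  have q2 : (c₂ - c₁) * deriv ψ₂ s < 0 := mul_neg_of_pos_of_neg (by linarith) p
  have : r * (ψ₂ s * (1 - ψ₂ s - h * φ₂ s))
      < r * (ψ₁ (s + τ) * (1 - ψ₁ (s + τ) - h * φ₁ (s + τ))) := by nlinarith
  exact lt_of_mul_lt_mul_left this hr.le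

/-- Ordering with shift `τ`. -/
def Good (φ₁ ψ₁ φ₂ ψ₂ : ℝ → ℝ) (τ : ℝ) : Prop :=
  ∀ s, φ₂ s ≤ φ₁ (s + τ) ∧ ψ₁ (s + τ) ≤ ψ₂ s

lemma good_strict (hd : 0 < d) (hr : 0 < r) (hh : h ∈ Ioo (0:ℝ) 1) (hk : k ∈ Ioo (0:ℝ) 1)
    (hc : c₁ < c₂) (H₁ : IsSemiWave d r h k c₁ φ₁ ψ₁)
    (H₂ : IsSemiWave d r h k c₂ φ₂ ψ₂) {τ : ℝ} (hτ : 0 ≤ τ) (G : Good φ₁ ψ₁ φ₂ ψ₂ τ) :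
    (∀ s > 0, φ₂ s < φ₁ (s + τ)) ∧ ∀ s, ψ₁ (s + τ) < ψ₂ s := by
  constructor
  · intro s hs
    refine lt_of_le_of_ne (G s).1 fun e => ?_
    have := touch_w hc H₁ H₂ hτ hs (fun t => by have := (G t).1; linarith)
    rw [← e] at this
    have h1 := lt_of_mul_lt_mul_left this (sw_nonneg H₂ s)
    have := mul_le_mul_of_nonneg_left (G s).2 hk.1.le
    linarith
  · intro s
    refine lt_of_le_of_ne (G s).2 fun e => ?_
    have := touch_z hd hr hc H₁ H₂ (s := s) (τ := τ) (fun t => by have := (G t).2; linarith)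
    rw [e] at this
    have h1 := lt_of_mul_lt_mul_left this (sw_psi_pos hh hk H₂ s).le
    have := mul_le_mul_of_nonneg_left (G s).1 hh.1.le
    linarith

lemma exists_M (hh : h ∈ Ioo (0:ℝ) 1) (hk : k ∈ Ioo (0:ℝ) 1)
    (H₁ : IsSemiWave d r h k c₁ φ₁ ψ₁)
    (H₂ : IsSemiWave d r h k c₂ φ₂ ψ₂) : ∃ M > 0,
      1 ≤ φ₁ M + φ₂ M * (1 - k) + k * vStar h k ∧
      1 ≤ (2 - h) * vStar h k + h * φ₂ M ∧ 1 / 2 ≤ ψ₂ (-M) := by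
  have h0 := hh.1; have h1 := hh.2; have k0 := hk.1; have k1 := hk.2
  have hkp : 0 < 1 - h * k := by nlinarith
  have ev1 : ∀ᶠ M in atTop, 1 < φ₁ M + φ₂ M * (1 - k) + k * vStar h k := by
    have t := (H₁.phi_atTop.add (H₂.phi_atTop.mul_const (1 - k))).add_const (k * vStar h k)
    apply t.eventually (lt_mem_nhds _)
    have : uStar h k + uStar h k * (1 - k) + k * vStar h k = 1 + uStar h k * (1 - k) := by
      have hne := hkp.ne'
      have e : uStar h k + k * vStar h k = 1 := by
        unfold uStar vStar
        rw [← mul_div_assoc, ← add_div, div_eq_one_iff_eq hne]; ring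
      linarith
    rw [this]
    have : 0 < uStar h k := div_pos (by linarith) hkp
    nlinarith
  have ev2 : ∀ᶠ M in atTop, 1 < (2 - h) * vStar h k + h * φ₂ M := by
    have t := (H₂.phi_atTop.const_mul h).const_add ((2 - h) * vStar h k)
    apply t.eventually (lt_mem_nhds _)
    have : (2 - h) * vStar h k + h * uStar h k = 1 + vStar h k * (1 - h) := by
      have hne := hkp.ne'
      unfold uStar vStar; field_simp; ring
    rw [this]
    have : 0 < vStar h k := div_pos (by linarith) hkp
    nlinarith
  have ev3 : ∀ᶠ M in atTop, 1 / 2 < ψ₂ (-M) :=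
    (H₂.psi_atBot.comp tendsto_neg_atTop_atBot).eventually (lt_mem_nhds (by norm_num))
  obtain ⟨M, a, b, c, e⟩ := (ev1.and (ev2.and (ev3.and (eventually_gt_atTop 0)))).exists
  exact ⟨M, e, a.le, b.le, c.le⟩

lemma good_of_compact (hd : 0 < d) (hr : 0 < r) (hh : h ∈ Ioo (0:ℝ) 1) (hk : k ∈ Ioo (0:ℝ) 1)
    (hc : c₁ < c₂) (H₁ : IsSemiWave d r h k c₁ φ₁ ψ₁)
    (H₂ : IsSemiWave d r h k c₂ φ₂ ψ₂) {τ M : ℝ} (hτ : 0 ≤ τ) (hM : 0 < M)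
    (M1 : 1 ≤ φ₁ M + φ₂ M * (1 - k) + k * vStar h k)
    (M2 : 1 ≤ (2 - h) * vStar h k + h * φ₂ M) (M3 : 1 / 2 ≤ ψ₂ (-M))
    (G1 : ∀ s ∈ Icc 0 M, φ₂ s ≤ φ₁ (s + τ))
    (G2 : ∀ s ∈ Icc (-M) M, ψ₁ (s + τ) ≤ ψ₂ s) : Good φ₁ ψ₁ φ₂ ψ₂ τ := by
  have h0 := hh.1; have h1 := hh.2; have k0 := hk.1; have k1 := hk.2
  set m : ℝ → ℝ := fun s => min (φ₁ (s + τ) - φ₂ s) (ψ₂ s - ψ₁ (s + τ)) with hm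
  have mc : Continuous m := by
    have := H₁.cont_phi; have := H₁.smooth_psi.continuous
    have := H₂.cont_phi; have := H₂.smooth_psi.continuous
    fun_prop
  have sT : Tendsto (fun s : ℝ => s + τ) atTop atTop := tendsto_atTop_add_const_right _ _ tendsto_id
  have sB : Tendsto (fun s : ℝ => s + τ) atBot atBot := tendsto_atBot_add_const_right _ _ tendsto_id
  have mT : Tendsto m atTop (nhds 0) := by
    have := ((H₁.phi_atTop.comp sT).sub H₂.phi_atTop).min
      (H₂.psi_atTop.sub (H₁.psi_atTop.comp sT))
    simpa using this
  have z1 : ∀ {c} {φ ψ : ℝ → ℝ}, IsSemiWave d r h k c φ ψ → Tendsto φ atBot (nhds 0) := by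
    intro c φ ψ H
    refine tendsto_const_nhds.congr' ?_
    filter_upwards [eventually_le_atBot 0] with s hs using (H.phi_zero s hs).symm
  have mB : Tendsto m atBot (nhds 0) := by
    have := (((z1 H₁).comp sB).sub (z1 H₂)).min
      (H₂.psi_atBot.sub (H₁.psi_atBot.comp sB))
    simpa using this
  suffices key : ∀ s, 0 ≤ m s by
    intro s
    have := le_min_iff.1 (key s)
    constructor <;> linarith [this.1, this.2]
  by_contra hcon
  push Not at hcon
  obtain ⟨x0, hx0⟩ := hcon
  have hco : ∀ᶠ x in cocompact ℝ, m x0 ≤ m x := by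
    rw [cocompact_eq_atBot_atTop, eventually_sup]
    exact ⟨(mB.eventually (lt_mem_nhds hx0)).mono fun _ h => h.le,
      (mT.eventually (lt_mem_nhds hx0)).mono fun _ h => h.le⟩
  obtain ⟨s, hs⟩ := mc.exists_forall_le' x0 hco
  have hms : m s < 0 := (hs x0).trans_lt hx0
  have hw : ∀ t, m s ≤ φ₁ (t + τ) - φ₂ t := fun t => (hs t).trans (min_le_left _ _)
  have hz : ∀ t, m s ≤ ψ₂ t - ψ₁ (t + τ) := fun t => (hs t).trans (min_le_right _ _)
  have hws := hw s
  have hzs := hz s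
  have p1 := sw_gt H₁ (s + τ)
  have p2 := sw_gt H₂ s
  have pp1 := sw_psi_pos hh hk H₁ (s + τ)
  have pp2 := sw_psi_pos hh hk H₂ s
  have n1 := sw_nonneg H₁ (s + τ)
  have n2 := sw_nonneg H₂ s
  rcases min_choice (φ₁ (s + τ) - φ₂ s) (ψ₂ s - ψ₁ (s + τ)) with e | e
  · have e : m s = φ₁ (s + τ) - φ₂ s := e
    have hsM : M < s := by
      by_contra hle
      push Not at hle
      rcases le_or_gt s 0 with h' | h'
      · rw [H₂.phi_zero s h'] at e; linarith
      · have := G1 s ⟨h'.le, hle⟩; linarith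
    have T := touch_w hc H₁ H₂ hτ (hM.trans hsM) (fun t => e ▸ hw t)
    have b1 : φ₁ M ≤ φ₁ (s + τ) := sw_mono H₁ (by linarith)
    have b2 : φ₂ M ≤ φ₂ s := sw_mono H₂ hsM.le
    generalize φ₁ (s + τ) = a at *
    generalize φ₂ s = b at *
    generalize ψ₁ (s + τ) = p at *
    generalize ψ₂ s = q at *
    have f1 : 0 ≤ a + b * (1 - k) + k * p - 1 := by nlinarith
    have f2 := mul_nonneg f1 (by linarith : 0 ≤ b - a)
    have f3 : 0 ≤ b * k * (q - p - (a - b)) :=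
      mul_nonneg (mul_nonneg n2 k0.le) (by linarith)
    nlinarith
  · have e : m s = ψ₂ s - ψ₁ (s + τ) := e
    have T := touch_z hd hr hc H₁ H₂ (s := s) (τ := τ) (fun t => e ▸ hz t)
    rcases lt_or_ge M s with hsM | hsM
    · have b2 : φ₂ M ≤ φ₂ s := sw_mono H₂ hsM.le
      generalize φ₁ (s + τ) = a at *
      generalize φ₂ s = b at *
      generalize ψ₁ (s + τ) = p at *
      generalize ψ₂ s = q at *
      have f1 : 0 ≤ p * (1 - h) + q + h * b - 1 := by nlinarith
      have f2 := mul_nonneg f1 (by linarith : 0 ≤ p - q)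
      have f3 : 0 ≤ p * h * (a - b - (q - p)) :=
        mul_nonneg (mul_nonneg pp1.le h0.le) (by linarith)
      nlinarith
    · have hsM' : s < -M := by
        by_contra hle
        push Not at hle
        have := G2 s ⟨hle, hsM⟩
        linarith
      have q2 : ψ₂ (-M) < ψ₂ s := sw_anti H₂ hsM'
      rw [H₂.phi_zero s (by linarith)] at T
      generalize φ₁ (s + τ) = a at *
      generalize ψ₁ (s + τ) = p at *
      generalize ψ₂ s = q at *
      have f1 := mul_nonneg (mul_nonneg pp1.le h0.le) n1
      have f2 : 0 ≤ (p - q) * (p + q - 1) := mul_nonneg (by linarith) (by linarith)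
      nlinarith

lemma good_zero (hd : 0 < d) (hr : 0 < r) (hh : h ∈ Ioo (0:ℝ) 1) (hk : k ∈ Ioo (0:ℝ) 1)
    (hc : c₁ < c₂) (H₁ : IsSemiWave d r h k c₁ φ₁ ψ₁)
    (H₂ : IsSemiWave d r h k c₂ φ₂ ψ₂) : Good φ₁ ψ₁ φ₂ ψ₂ 0 := by
  obtain ⟨M, hM, M1, M2, M3⟩ := exists_M hh hk H₁ H₂
  have f1 := H₁.cont_phi
  have g1 := H₁.smooth_psi.continuous
  have f2 := H₂.cont_phi
  have g2 := H₂.smooth_psi.continuous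
  set S : Set ℝ := {τ | 0 ≤ τ ∧ Good φ₁ ψ₁ φ₂ ψ₂ τ} with hS
  have Sc : IsClosed S := by
    have : S = Ici 0 ∩ ⋂ s, ({τ | φ₂ s ≤ φ₁ (s + τ)} ∩ {τ | ψ₁ (s + τ) ≤ ψ₂ s}) := by
      ext τ; simp [hS, Good]
    rw [this]
    refine isClosed_Ici.inter (isClosed_iInter fun s => ?_)
    exact (isClosed_le (by fun_prop) (by fun_prop)).inter (isClosed_le (by fun_prop) (by fun_prop))
  have Sne : S.Nonempty := by
    have e1 := H₁.phi_atTop.eventually (lt_mem_nhds (sw_lt H₂ M))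
    have e2 := H₁.psi_atTop.eventually (gt_mem_nhds (sw_gt H₂ M))
    obtain ⟨t, a, b, ht⟩ := (e1.and (e2.and (eventually_ge_atTop 0))).exists
    refine ⟨t + M, by linarith, ?_⟩
    refine good_of_compact hd hr hh hk hc H₁ H₂ (by linarith) hM M1 M2 M3 ?_ ?_
    · intro s hs
      calc φ₂ s ≤ φ₂ M := sw_mono H₂ hs.2
        _ ≤ φ₁ t := a.le
        _ ≤ _ := sw_mono H₁ (by linarith [hs.1])
    · intro s hs
      calc ψ₁ (s + (t + M)) ≤ ψ₁ t := (sw_anti H₁).antitone (by linarith [hs.1])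
        _ ≤ ψ₂ M := b.le
        _ ≤ _ := (sw_anti H₂).antitone hs.2
  have Sb : BddBelow S := ⟨0, fun x hx => hx.1⟩
  obtain ⟨t0, tG⟩ := Sc.csInf_mem Sne Sb
  set t := sInf S with ht
  rcases t0.eq_or_lt with h0 | h0
  · rwa [← h0] at tG
  exfalso
  obtain ⟨w, z⟩ := good_strict hd hr hh hk hc H₁ H₂ t0 tG
  have E1 : ∀ᶠ τ in nhds t, ∀ s ∈ Icc 0 M, φ₂ s < φ₁ (s + τ) := by
    apply isCompact_Icc.eventually_forall_of_forall_eventually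
    intro s hs
    have hlt : φ₂ s < φ₁ (s + t) := by
      rcases hs.1.eq_or_lt with h' | h'
      · rw [← h', H₂.phi_zero 0 le_rfl]; exact sw_pos H₁ _ (by linarith)
      · exact w s h'
    exact (isOpen_lt (f := fun p : ℝ × ℝ => φ₂ p.2) (g := fun p : ℝ × ℝ => φ₁ (p.2 + p.1))
      (by fun_prop) (by fun_prop)).mem_nhds hlt
  have E2 : ∀ᶠ τ in nhds t, ∀ s ∈ Icc (-M) M, ψ₁ (s + τ) < ψ₂ s := by
    apply isCompact_Icc.eventually_forall_of_forall_eventually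
    intro s hs
    exact (isOpen_lt (f := fun p : ℝ × ℝ => ψ₁ (p.2 + p.1)) (g := fun p : ℝ × ℝ => ψ₂ p.2)
      (by fun_prop) (by fun_prop)).mem_nhds (z s)
  have E : ∀ᶠ τ in nhdsWithin t (Iio t), (∀ s ∈ Icc 0 M, φ₂ s < φ₁ (s + τ)) ∧
      (∀ s ∈ Icc (-M) M, ψ₁ (s + τ) < ψ₂ s) ∧ 0 < τ :=
    (E1.and (E2.and (lt_mem_nhds h0))).filter_mono nhdsWithin_le_nhds
  obtain ⟨τ, ⟨a, b, c⟩, hlt⟩ := (E.and self_mem_nhdsWithin).exists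
  have : τ ∈ S := ⟨c.le, good_of_compact hd hr hh hk hc H₁ H₂ c.le hM M1 M2 M3
    (fun s hs => (a s hs).le) (fun s hs => (b s hs).le)⟩
  exact absurd (csInf_le Sb this) (not_le.2 hlt)
end compare

theorem stmt10 (d r h k c₁ c₂ : ℝ) (hd : 0 < d) (hr : 0 < r)
    (hh : h ∈ Set.Ioo (0:ℝ) 1) (hk : k ∈ Set.Ioo (0:ℝ) 1)
    (hc₁ : 0 ≤ c₁) (hc : c₁ < c₂)
    (φ₁ ψ₁ φ₂ ψ₂ : ℝ → ℝ)
    (hsw₁ : IsSemiWave d r h k c₁ φ₁ ψ₁) (hsw₂ : IsSemiWave d r h k c₂ φ₂ ψ₂) :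
    derivWithin φ₂ (Set.Ici 0) 0 < derivWithin φ₁ (Set.Ici 0) 0 ∧
    (∀ s > (0:ℝ), φ₂ s < φ₁ s) ∧
    (∀ s : ℝ, ψ₁ s < ψ₂ s) := by
  have G := good_zero hd hr hh hk hc hsw₁ hsw₂
  obtain ⟨w, z⟩ := good_strict hd hr hh hk hc hsw₁ hsw₂ le_rfl G
  simp only [add_zero] at w z
  refine ⟨?_, w, z⟩
  by_contra hcon
  push Not at hcon
  have f1 := hsw₁.cont_phi
  have g1 := hsw₁.smooth_psi.continuous
  have f2 := hsw₂.cont_phi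
  have g2 := hsw₂.smooth_psi.continuous
  have hp := sw_dw_pos hh hk hsw₂
  have hcont : ContinuousOn (fun s => -(c₂ - c₁) * derivWithin φ₂ (Ici 0) s
      - φ₁ s * (1 - φ₁ s - k * ψ₁ s) + φ₂ s * (1 - φ₂ s - k * ψ₂ s)) (Ici 0) := by
    have := sw_dwc hsw₂
    exact ((continuousOn_const.mul this).sub
      (by fun_prop : Continuous fun s => φ₁ s * (1 - φ₁ s - k * ψ₁ s)).continuousOn).add
      (by fun_prop : Continuous fun s => φ₂ s * (1 - φ₂ s - k * ψ₂ s)).continuousOn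
  have hev := (hcont 0 self_mem_Ici).eventually (gt_mem_nhds (a := (0:ℝ)) (by
    show -(c₂ - c₁) * derivWithin φ₂ (Ici 0) 0
      - φ₁ 0 * (1 - φ₁ 0 - k * ψ₁ 0) + φ₂ 0 * (1 - φ₂ 0 - k * ψ₂ 0) < 0
    rw [hsw₁.phi_zero 0 le_rfl, hsw₂.phi_zero 0 le_rfl]
    nlinarith))
  rw [eventually_nhdsWithin_iff] at hev
  obtain ⟨δ, hδ, hb⟩ := Metric.eventually_nhds_iff.1 hev
  obtain ⟨s, hs, hn⟩ := hopf (f := fun s => φ₁ s - φ₂ s)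
    (f1 := fun s => derivWithin φ₁ (Ici 0) s - derivWithin φ₂ (Ici 0) s)
    (f2 := fun s => deriv (deriv φ₁) s - deriv (deriv φ₂) s) (c := c₁) hδ
    (f1.sub f2).continuousOn ((sw_dwc hsw₁).sub (sw_dwc hsw₂))
    (fun s hs => by
      rw [sw_dw hsw₁ s hs, sw_dw hsw₂ s hs]
      exact (sw_d1 hsw₁ s hs).sub (sw_d1 hsw₂ s hs))
    (fun s hs => (sw_dw2 hsw₁ s hs).sub (sw_dw2 hsw₂ s hs))
    (by simp [hsw₁.phi_zero 0 le_rfl, hsw₂.phi_zero 0 le_rfl])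
    (by simpa using hcon)
    (by
      intro s hs hsd
      have h1 := hb (y := s) (by rw [Real.dist_eq, sub_zero, abs_of_pos hs]; exact hsd) hs.le
      rw [sw_dw hsw₂ s hs] at h1 ⊢
      rw [sw_dw hsw₁ s hs]
      have e1 := hsw₁.ode_phi s hs
      have e2 := hsw₂.ode_phi s hs
      linarith)
  have := w s hs
  linarith
end
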